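/- arXiv:0805.4439 — 2 statements merged into one kernel-verified Lean document; each statement's English description precedes it below -/
import Mathlib

section
/- Let k be a probability Borel measure on ℝ with compact support. Define the logarithmic potential γ(x) = ∫_ℝ ln|t−x| dk(t) (with values in [−∞, ∞); γ(x) is finite for Lebesgue-a.e. x), and let g(x) = lim_{y→0+} ∫_ℝ dk(t)/(t−x−iy), which exists for Lebesgue-a.e. x ∈ ℝ. Then for Lebesgue-almost every x ∈ ℝ, γ is approximately differentiable at x and its approximate derivative satisfies (D_ap γ)(x) = −Re g(x). -/
open MeasureTheory Filter Topology

/-- The logarithmic potential `γ(x) = ∫ ln|t - x| dk(t)` of a measure `k` on `ℝ`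
(as a Bochner integral; for a compactly supported probability measure it is finite
and agrees with the usual potential at Lebesgue-a.e. `x`). -/
noncomputable def logPotential (k : Measure ℝ) (x : ℝ) : ℝ :=
  ∫ t, Real.log (|t - x|) ∂k

/-- `f` is approximately differentiable at `x` with approximate derivative `d`:
for every `ε > 0`, `(1/(2h)) |{y ∈ (-h,h) : |(f(x+y) - f x)/y - d| ≥ ε}| → 0`
as `h → 0+`. -/
def HasApproxDerivAt (f : ℝ → ℝ) (d x : ℝ) : Prop :=
  ∀ ε > (0 : ℝ), Tendsto
    (fun h : ℝ =>
      (volume {y : ℝ | y ∈ Set.Ioo (-h) h ∧ ε ≤ |(f (x + y) - f x) / y - d|}).toReal /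
        (2 * h))
    (𝓝[>] (0 : ℝ)) (𝓝 0)

open Complex in
/-- **Phragmén–Lindelöf principle** for bounded functions in the upper half-plane. -/
theorem norm_le_of_bounded_upperHalfPlane {f : ℂ → ℂ} {M C : ℝ}
    (hd : DiffContOnCl ℂ f {z | 0 < z.im}) (hM : ∀ z : ℂ, 0 ≤ z.im → ‖f z‖ ≤ M)
    (hC : ∀ x : ℝ, ‖f x‖ ≤ C) {z : ℂ} (hz : 0 ≤ z.im) : ‖f z‖ ≤ C := by
  have hmaps : Set.MapsTo (fun w : ℂ => I * w) {w | 0 < w.re} {z | 0 < z.im} := by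
    intro w hw
    simpa using hw
  have hg : DiffContOnCl ℂ (fun w : ℂ => f (I * w)) {w | 0 < w.re} :=
    hd.comp (g := fun w : ℂ => I * w)
      (Differentiable.diffContOnCl (by fun_prop)) hmaps
  have key := PhragmenLindelof.right_half_plane_of_bounded_on_real (C := C) (z := -I * z) hg
    ⟨1, by norm_num, 0, ?_⟩ ?_ ?_ (by simpa using hz)
  · have h1 : I * (-I * z) = z := by
      rw [← mul_assoc]; simp
    simpa only [h1] using key
  · simp only [zero_mul, Real.exp_zero]
    refine Asymptotics.IsBigO.of_bound M ?_
    rw [eventually_inf_principal]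
    refine Eventually.of_forall fun w hw => ?_
    have hw' : 0 < w.re := hw
    simpa using hM (I * w) (by simpa using hw'.le)
  · refine isBoundedUnder_of_eventually_le (a := M) ?_
    filter_upwards [eventually_ge_atTop 0] with x hx
    exact hM _ (by simpa using hx)
  · intro x
    have h1 : I * (x * I) = ((-x : ℝ) : ℂ) := by
      rw [mul_comm, mul_assoc, I_mul_I]; push_cast; ring
    simpa only [h1] using hC (-x)

open Complex in
/-- A function of linear growth, holomorphic in the upper half-plane and continuous up to the real
line, which is `o(s)` along the real line at `0` is `o(z)` in the upper half-plane at `0`. -/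
theorem exists_norm_le_of_isLittleO_real {H : ℂ → ℂ} {M : ℝ} (hc : Continuous H)
    (hd : DifferentiableOn ℂ H {z | 0 < z.im}) (hM : ∀ z, ‖H z‖ ≤ M * ‖z‖)
    (ho : ∀ ε > 0, ∃ R > 0, ∀ s : ℝ, |s| ≤ R → ‖H s‖ ≤ ε * |s|) {ε : ℝ} (hε : 0 < ε) :
    ∃ r > 0, ∀ z : ℂ, 0 ≤ z.im → ‖z‖ ≤ r → ‖H z‖ ≤ ε * ‖z‖ := by
  have hM0 : 0 ≤ M := by simpa using (norm_nonneg _).trans (hM 1)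
  obtain ⟨R, hR, hR'⟩ := ho (ε / 4) (by positivity)
  obtain ⟨m, hm⟩ : ∃ m : ℕ, M * (1 / 2 : ℝ) ^ m ≤ ε / 4 := by
    have h1 : Tendsto (fun m : ℕ => M * (1 / 2 : ℝ) ^ m) atTop (𝓝 (M * 0)) :=
      (tendsto_pow_atTop_nhds_zero_of_lt_one (by norm_num) (by norm_num)).const_mul M
    rw [mul_zero] at h1
    exact (h1.eventually_le_const (by positivity)).exists
  have hlow : ∀ (η : ℝ), 0 < η → ∀ z : ℂ, 0 ≤ z.im → ‖z‖ ≤ ‖z + η * I‖ ∧ η ≤ ‖z + η * I‖ := by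
    intro η hη z hz
    constructor
    · rw [Complex.norm_def, Complex.norm_def]
      apply Real.sqrt_le_sqrt
      simp only [normSq_apply, add_re, mul_re, ofReal_re, I_re, ofReal_im, I_im, add_im, mul_im]
      nlinarith
    · refine le_trans ?_ (Complex.abs_im_le_norm _)
      refine le_trans ?_ (le_abs_self _)
      simp; exact hz
  have hbound : ∀ z : ℂ, 0 ≤ z.im → z ≠ 0 →
      ‖H z‖ ≤ ε / 4 * (2 * ‖z‖) * (1 + ‖z‖ / R) ^ (2 * m) := by
    intro z hz hz0
    set η := ‖z‖
    have hη : 0 < η := norm_pos_iff.2 hz0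
    have hne : ∀ (η : ℝ), 0 < η → ∀ z : ℂ, 0 ≤ z.im → z + η * I ≠ 0 := fun η hη z hz =>
      norm_pos_iff.1 (hη.trans_le (hlow η hη z hz).2)
    let Q : ℂ → ℂ := fun z => H z / (z + η * I) * ((R : ℂ) / (z + R * I)) ^ (2 * m)
    have hQ1 : ∀ z : ℂ, 0 ≤ z.im → ‖H z / (z + η * I)‖ ≤ M := by
      intro z hz
      rw [norm_div, div_le_iff₀ (hη.trans_le (hlow η hη z hz).2)]
      exact (hM z).trans (mul_le_mul_of_nonneg_left (hlow η hη z hz).1 hM0)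
    have hQ2 : ∀ z : ℂ, 0 ≤ z.im → ‖(R : ℂ) / (z + R * I)‖ ≤ 1 := by
      intro z hz
      rw [norm_div, div_le_one₀ (hR.trans_le (hlow R hR z hz).2)]
      simpa [abs_of_pos hR] using (hlow R hR z hz).2
    have hQd : DiffContOnCl ℂ Q {z | 0 < z.im} := by
      refine ⟨?_, ?_⟩
      · intro w hw
        have hw' : 0 < w.im := hw
        have hHw := hd w hw
        have := hne η hη w hw'.le
        have := hne R hR w hw'.le
        fun_prop (disch := assumption)
      · have hcl : closure {z : ℂ | 0 < z.im} ⊆ {z | 0 ≤ z.im} :=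
          closure_minimal (fun w (hw : 0 < w.im) => hw.le)
            (isClosed_le continuous_const Complex.continuous_im)
        refine ContinuousOn.mono ?_ hcl
        intro w hw
        have := hne η hη w hw
        have := hne R hR w hw
        have : ContinuousAt Q w := by
          have := hc.continuousAt (x := w)
          fun_prop (disch := assumption)
        exact this.continuousWithinAt
    have hQz : ‖Q z‖ ≤ ε / 4 := by
      refine norm_le_of_bounded_upperHalfPlane (M := M) hQd ?_ ?_ hz
      · intro w hw
        simp only [Q, norm_mul, norm_pow]
        exact (mul_le_of_le_one_right (norm_nonneg _)
          (pow_le_one₀ (norm_nonneg _) (hQ2 w hw))).trans (hQ1 w hw)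
      · intro s
        simp only [Q, norm_mul, norm_pow]
        rcases le_total |s| R with hs | hs
        · refine (mul_le_of_le_one_right (norm_nonneg _)
            (pow_le_one₀ (norm_nonneg _) (hQ2 s (by simp)))).trans ?_
          have h1 := hlow η hη s (by simp)
          rw [norm_div, div_le_iff₀ (hη.trans_le h1.2)]
          refine (hR' s hs).trans ?_
          gcongr
          simpa using h1.1
        · have h2 : ‖(R : ℂ) / (s + R * I)‖ ^ 2 ≤ 1 / 2 := by
            rw [norm_div, div_pow, ← Complex.normSq_eq_norm_sq, ← Complex.normSq_eq_norm_sq,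
              normSq_add_mul_I, normSq_ofReal]
            rw [div_le_iff₀ (by positivity)]
            nlinarith [sq_abs s]
          rw [pow_mul]
          refine le_trans ?_ hm
          gcongr
          exact hQ1 s (by simp)
    have hzR : ‖z + R * I‖ ≤ R * (1 + ‖z‖ / R) := by
      refine (norm_add_le _ _).trans (le_of_eq ?_)
      simp [abs_of_pos hR]
      field_simp
      ring
    have hzη : ‖z + η * I‖ ≤ 2 * ‖z‖ := by
      refine (norm_add_le _ _).trans (le_of_eq ?_)
      simp [η]
      ring
    have hHQ : H z = Q z * (z + η * I) * ((z + R * I) / R) ^ (2 * m) := by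
      have h1 := hne η hη z hz
      have h2 := hne R hR z hz
      have h3 : (R : ℂ) ≠ 0 := by exact_mod_cast hR.ne'
      simp only [Q, div_pow]
      generalize z + R * I = b at h2 ⊢
      generalize z + η * I = a at h1 ⊢
      field_simp
    rw [hHQ, norm_mul, norm_mul, norm_pow, norm_div]
    gcongr
    rw [Complex.norm_real, Real.norm_of_nonneg hR.le, div_le_iff₀ hR]
    linarith
  have hcont : Tendsto (fun t : ℝ => (1 + t / R) ^ (2 * m)) (𝓝 0) (𝓝 1) :=
    Continuous.tendsto' (by fun_prop) _ _ (by simp)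
  obtain ⟨r, hr, hr'⟩ := Metric.eventually_nhds_iff_ball.1
    (hcont.eventually_le_const (u := 2) (by norm_num))
  refine ⟨r / 2, by positivity, fun z hz hzr => ?_⟩
  rcases eq_or_ne z 0 with rfl | hz0
  · simpa using hM 0
  refine (hbound z hz hz0).trans ?_
  have := hr' ‖z‖ (by rw [Metric.mem_ball, dist_zero_right, norm_norm]; linarith)
  nlinarith [mul_le_mul_of_nonneg_left this (show 0 ≤ ε / 4 * (2 * ‖z‖) by positivity)]

open Complex in
/-- **Fatou's theorem**: a bounded holomorphic function in the upper half-plane has vertical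
boundary limits at almost every real point. -/
theorem ae_exists_tendsto_of_bounded_upperHalfPlane {F : ℂ → ℂ} {C : ℝ}
    (hd : DifferentiableOn ℂ F {z | 0 < z.im}) (hC : ∀ z : ℂ, 0 < z.im → ‖F z‖ ≤ C) :
    ∀ᵐ x : ℝ, ∃ L : ℂ, Tendsto (fun y : ℝ => F (x + y * I)) (𝓝[>] (0 : ℝ)) (𝓝 L) := by
  have hconv : Convex ℝ {z : ℂ | 0 < z.im} := convex_halfSpace_im_gt 0
  have hopen : IsOpen {z : ℂ | 0 < z.im} := isOpen_lt continuous_const Complex.continuous_im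
  obtain ⟨G₀, hG₀⟩ := hconv.exists_forall_hasDerivWithinAt hd
  have hlip := hconv.lipschitzOnWith_of_nnnorm_hasDerivWithin_le (C := C.toNNReal) hG₀
    (fun z hz => by
      rw [← NNReal.coe_le_coe, coe_nnnorm]
      exact (hC z hz).trans (Real.le_coe_toNNReal C))
  obtain ⟨G, hG, hGG₀⟩ := hlip.extend_finite_dimension
  set K := lipschitzExtensionConstant ℂ * C.toNNReal
  have hGd : ∀ z : ℂ, 0 < z.im → HasDerivAt G (F z) z := fun z hz =>
    ((hG₀ z hz).hasDerivAt (hopen.mem_nhds hz)).congr_of_eventuallyEq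
      (by filter_upwards [hopen.mem_nhds hz] with w hw using (hGG₀ hw).symm)
  have hGr : LipschitzWith (K * 1) (fun x : ℝ => G x) :=
    hG.comp (f := G) (g := fun x : ℝ => (x : ℂ)) Complex.isometry_ofReal.lipschitz
  filter_upwards [hGr.ae_differentiableAt] with x hx
  obtain ⟨d, hxd⟩ : ∃ d, HasDerivAt (fun x : ℝ => G x) d x := ⟨_, hx.hasDerivAt⟩
  refine ⟨d, ?_⟩
  let H : ℂ → ℂ := fun z => G (x + z) - G x - d * z
  have hHd : ∀ z : ℂ, 0 < z.im → HasDerivAt H (F (x + z) - d) z := by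
    intro z hz
    have h1 : HasDerivAt (fun z => G (x + z)) (F (x + z)) z :=
      HasDerivAt.comp_const_add _ _ (hGd (x + z) (by simpa using hz))
    simpa using (h1.sub_const (G x)).fun_sub ((hasDerivAt_id' z).const_mul d)
  have hHc : Continuous H := by
    have := hG.continuous
    fun_prop
  have hHM : ∀ z, ‖H z‖ ≤ (K + ‖d‖) * ‖z‖ := by
    intro z
    have h1 := hG.dist_le_mul (x + z) x
    rw [dist_eq_norm, dist_eq_norm, add_sub_cancel_left] at h1
    calc ‖H z‖ ≤ ‖G (x + z) - G x‖ + ‖d * z‖ := norm_sub_le _ _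
      _ ≤ K * ‖z‖ + ‖d‖ * ‖z‖ := by rw [norm_mul]; gcongr
      _ = _ := by ring
  have hHo : ∀ ε > 0, ∃ R > 0, ∀ s : ℝ, |s| ≤ R → ‖H s‖ ≤ ε * |s| := by
    intro ε hε
    have h1 := (hasDerivAt_iff_isLittleO_nhds_zero.1 hxd).def hε
    obtain ⟨R, hR, hR'⟩ := Metric.eventually_nhds_iff_ball.1 h1
    refine ⟨R / 2, by positivity, fun s hs => ?_⟩
    have := hR' s (by rw [Metric.mem_ball, dist_zero_right, Real.norm_eq_abs]; linarith)
    simpa [H, mul_comm] using this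
  rw [Metric.tendsto_nhds]
  intro ε hε
  obtain ⟨r, hr, hr'⟩ := exists_norm_le_of_isLittleO_real hHc
    (fun z hz => (hHd z hz).differentiableAt.differentiableWithinAt) hHM hHo
    (show 0 < ε / 4 by positivity)
  filter_upwards [Ioo_mem_nhdsGT (show 0 < r / 2 by positivity)] with y hy
  have hy0 : 0 < y := hy.1
  have hsub : ∀ z ∈ Metric.closedBall (y * I) (y / 2), 0 < z.im ∧ ‖z‖ ≤ 3 / 2 * y := by
    intro z hz
    rw [Metric.mem_closedBall, dist_eq_norm] at hz
    have h1 := (Complex.abs_im_le_norm _).trans hz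
    have h2 : ‖z‖ ≤ ‖z - y * I‖ + ‖y * I‖ := by simpa using norm_add_le (z - y * I) (y * I)
    simp [abs_of_pos hy0] at h1 h2
    rw [abs_le] at h1
    constructor <;> linarith
  have hder := Complex.norm_deriv_le_of_forall_mem_sphere_norm_le (f := H) (c := y * I)
    (R := y / 2) (C := ε / 4 * (3 / 2 * y)) (by positivity) ?_ ?_
  · rw [(hHd (y * I) (by simpa using hy0)).deriv] at hder
    rw [dist_eq_norm]
    refine hder.trans_lt ?_
    rw [div_lt_iff₀ (by positivity)]
    nlinarith
  · refine (DifferentiableOn.diffContOnCl_ball (U := {z : ℂ | 0 < z.im}) ?_ ?_)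
    · exact fun z hz => (hHd z hz).differentiableAt.differentiableWithinAt
    · exact fun z hz => (hsub z hz).1
  · intro z hz
    obtain ⟨h1, h2⟩ := hsub z (Metric.sphere_subset_closedBall hz)
    refine (hr' z h1.le (by linarith [hy.2])).trans ?_
    gcongr

/-- A continuous phase `θ` on `(0, ∞)` converges at `0` if `exp (i θ)` does. -/
theorem exists_tendsto_of_tendsto_exp_mul_I {θ : ℝ → ℝ} (hθ : ContinuousOn θ (Set.Ioi 0)) {c : ℂ}
    (hc : Tendsto (fun y => Complex.exp (θ y * Complex.I)) (𝓝[>] (0 : ℝ)) (𝓝 c)) :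
    ∃ l : ℝ, Tendsto θ (𝓝[>] (0 : ℝ)) (𝓝 l) := by
  have hc1 : ‖c‖ = 1 := by
    refine tendsto_nhds_unique hc.norm ?_
    simp [Complex.norm_exp_ofReal_mul_I]
  set a := c.arg
  have hca : c = Complex.exp (a * Complex.I) := by
    simpa [hc1] using (Complex.norm_mul_exp_arg_mul_I c).symm
  have h1 : Tendsto (fun y => Complex.exp ((θ y - a : ℝ) * Complex.I)) (𝓝[>] (0 : ℝ)) (𝓝 1) := by
    have := hc.mul_const (Complex.exp (-a * Complex.I))
    rw [hca, ← Complex.exp_add] at this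
    convert this using 2 with y
    · rw [← Complex.exp_add]; push_cast; ring_nf
    · simp
  have hcos : Tendsto (fun y => Real.cos (θ y - a)) (𝓝[>] (0 : ℝ)) (𝓝 1) := by
    simpa only [Function.comp_def, Complex.exp_ofReal_mul_I_re, Complex.one_re] using
      (Complex.continuous_re.tendsto _).comp h1
  have hsin : Tendsto (fun y => Real.sin (θ y - a)) (𝓝[>] (0 : ℝ)) (𝓝 0) := by
    simpa only [Function.comp_def, Complex.exp_ofReal_mul_I_im, Complex.one_im] using
      (Complex.continuous_im.tendsto _).comp h1
  obtain ⟨δ, hδ, hδ'⟩ := mem_nhdsGT_iff_exists_Ioo_subset.1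
    (hcos.eventually_const_lt (u := 0) one_pos)
  have hδ0 : 0 < δ := hδ
  set n := round ((θ (δ / 2) - a) / (2 * Real.pi))
  set φ : ℝ → ℝ := fun y => θ y - a - n * (2 * Real.pi)
  have hφcos : ∀ y ∈ Set.Ioo 0 δ, 0 < Real.cos (φ y) := fun y hy => by
    simp only [φ, Real.cos_sub_int_mul_two_pi]
    exact hδ' hy
  have hmem : δ / 2 ∈ Set.Ioo 0 δ := ⟨by linarith, by linarith⟩
  have hφ1 : |φ (δ / 2)| ≤ Real.pi := by
    have h2 := abs_sub_round ((θ (δ / 2) - a) / (2 * Real.pi))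
    have h3 : φ (δ / 2) = ((θ (δ / 2) - a) / (2 * Real.pi) - n) * (2 * Real.pi) := by
      simp only [φ]
      field_simp
    rw [h3, abs_mul, abs_of_pos Real.two_pi_pos]
    nlinarith [Real.pi_pos]
  have hφ2 : |φ (δ / 2)| < Real.pi / 2 := by
    by_contra! h
    have := Real.cos_nonpos_of_pi_div_two_le_of_le h (by linarith [Real.pi_pos])
    rw [Real.cos_abs] at this
    linarith [hφcos _ hmem]
  have hφ3 : ∀ y ∈ Set.Ioo 0 δ, |φ y| < Real.pi / 2 := by
    intro y hy
    by_contra! h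
    have hsub : Set.uIcc (δ / 2) y ⊆ Set.Ioo 0 δ := Set.ordConnected_Ioo.uIcc_subset hmem hy
    have hcont : ContinuousOn (fun y => |φ y|) (Set.uIcc (δ / 2) y) := by
      have : ContinuousOn θ (Set.uIcc (δ / 2) y) :=
        hθ.mono (hsub.trans fun z hz => hz.1)
      fun_prop
    obtain ⟨z, hz, hz'⟩ := intermediate_value_uIcc hcont (Set.mem_uIcc_of_le hφ2.le h)
    have h4 := hφcos z (hsub hz)
    rw [← Real.cos_abs, show |φ z| = Real.pi / 2 from hz', Real.cos_pi_div_two] at h4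
    exact lt_irrefl _ h4
  refine ⟨a + n * (2 * Real.pi), ?_⟩
  have harc : Tendsto (fun y => Real.arcsin (Real.sin (θ y - a)) + (a + n * (2 * Real.pi)))
      (𝓝[>] (0 : ℝ)) (𝓝 (a + n * (2 * Real.pi))) := by
    have := ((Real.continuous_arcsin.tendsto 0).comp hsin).add_const (a + n * (2 * Real.pi))
    simpa using this
  refine harc.congr' ?_
  filter_upwards [Ioo_mem_nhdsGT hδ0] with y hy
  have h5 : Real.sin (θ y - a) = Real.sin (φ y) := by
    simp only [φ, Real.sin_sub_int_mul_two_pi]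
  have h6 := abs_lt.1 (hφ3 y hy)
  rw [h5, Real.arcsin_sin (by linarith) h6.2.le]
  simp only [φ]
  ring

open Complex in
/-- If a holomorphic function maps the upper half-plane into itself and its imaginary part has
finite vertical boundary limits at almost every real point, then so does the function itself. -/
theorem ae_exists_tendsto_of_im_nonneg {g : ℂ → ℂ} (hd : DifferentiableOn ℂ g {z | 0 < z.im})
    (hg : ∀ z : ℂ, 0 < z.im → 0 ≤ (g z).im)
    (him : ∀ᵐ x : ℝ, ∃ v : ℝ,
      Tendsto (fun y : ℝ => (g (x + y * I)).im) (𝓝[>] (0 : ℝ)) (𝓝 v)) :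
    ∀ᵐ x : ℝ, ∃ L : ℂ, Tendsto (fun y : ℝ => g (x + y * I)) (𝓝[>] (0 : ℝ)) (𝓝 L) := by
  have hF : ∀ᵐ x : ℝ, ∃ L : ℂ,
      Tendsto (fun y : ℝ => exp (g (x + y * I) * I)) (𝓝[>] (0 : ℝ)) (𝓝 L) := by
    refine ae_exists_tendsto_of_bounded_upperHalfPlane (F := fun z => exp (g z * I)) (C := 1)
      (by fun_prop) fun z hz => ?_
    rw [norm_exp]
    simpa using hg z hz
  filter_upwards [him, hF] with x ⟨v, hv⟩ ⟨w, hw⟩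
  have hphase : Tendsto (fun y : ℝ => exp (((g (x + y * I)).re : ℂ) * I)) (𝓝[>] (0 : ℝ))
      (𝓝 (w * exp v)) := by
    have h1 : Tendsto (fun y : ℝ => exp ((g (x + y * I)).im : ℂ)) (𝓝[>] (0 : ℝ)) (𝓝 (exp v)) :=
      ((continuous_exp.comp continuous_ofReal).tendsto v).comp hv
    refine (hw.mul h1).congr fun y => ?_
    rw [← exp_add]
    congr 1
    nth_rewrite 1 [← re_add_im (g (x + y * I))]
    rw [add_mul, mul_assoc, I_mul_I]
    ring
  have hcont : ContinuousOn (fun y : ℝ => (g (x + y * I)).re) (Set.Ioi 0) := by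
    refine continuous_re.comp_continuousOn (hd.continuousOn.comp (by fun_prop) fun y hy => ?_)
    simpa using hy
  obtain ⟨l, hl⟩ := exists_tendsto_of_tendsto_exp_mul_I hcont hphase
  refine ⟨l + v * I, ?_⟩
  have h2 := ((continuous_ofReal.tendsto l).comp hl).add
    (((continuous_ofReal.tendsto v).comp hv).mul_const I)
  simpa only [Function.comp_def, re_add_im] using h2

open Complex in
/-- The Cauchy transform of a finite measure on the line is holomorphic in the upper half-plane. -/
theorem differentiableOn_cauchyTransform (k : Measure ℝ) [IsFiniteMeasure k] :
    DifferentiableOn ℂ (fun z : ℂ => ∫ t : ℝ, ((t : ℂ) - z)⁻¹ ∂k) {z | 0 < z.im} := by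
  intro z₀ hz₀
  have hz₀' : 0 < z₀.im := hz₀
  have hlow : ∀ (z : ℂ) (t : ℝ), z.im ≤ ‖(t : ℂ) - z‖ := fun z t => by
    have := Complex.abs_im_le_norm ((t : ℂ) - z)
    simp only [sub_im, ofReal_im, zero_sub, abs_neg] at this
    exact (le_abs_self _).trans this
  have hopen : IsOpen {z : ℂ | z₀.im / 2 < z.im} := isOpen_lt continuous_const continuous_im
  have hmeas : ∀ z : ℂ, AEStronglyMeasurable (fun t : ℝ => ((t : ℂ) - z)⁻¹) k := fun z =>
    Measurable.aestronglyMeasurable (by fun_prop)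
  refine (hasDerivAt_integral_of_dominated_loc_of_deriv_le
    (F := fun (z : ℂ) (t : ℝ) => ((t : ℂ) - z)⁻¹) (F' := fun z t => (((t : ℂ) - z) ^ 2)⁻¹)
    (bound := fun _ => ((z₀.im / 2) ^ 2)⁻¹)
    (hopen.mem_nhds (by simp; linarith)) (Eventually.of_forall hmeas) ?_
    (Measurable.aestronglyMeasurable (by fun_prop)) ?_ (integrable_const _)
    ?_).2.differentiableAt.differentiableWithinAt
  · refine Integrable.of_bound (hmeas _) (z₀.im)⁻¹ (Eventually.of_forall fun t => ?_)
    rw [norm_inv]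
    exact inv_anti₀ hz₀' (hlow z₀ t)
  · refine Eventually.of_forall fun t z hz => ?_
    have hz' : z₀.im / 2 < z.im := hz
    rw [norm_inv, norm_pow]
    exact inv_anti₀ (by positivity)
      (pow_le_pow_left₀ (by positivity) (hz'.le.trans (hlow z t)) 2)
  · refine Eventually.of_forall fun t z hz => ?_
    have hz' : z₀.im / 2 < z.im := hz
    have hne : (t : ℂ) - z ≠ 0 := norm_pos_iff.1 (by linarith [hlow z t])
    have := ((hasDerivAt_id' z).const_sub (t : ℂ)).fun_inv hne
    simpa [div_eq_mul_inv] using this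

/-- `c` is the density at `0` of the measure `κ`, in the strong (Lebesgue point) sense: on `[-1, 1]`
one has `κ = c • volume + σ₁ - σ₂` where `σ₁ + σ₂` has density zero at `0`. -/
structure IsLebesgueDensityAtZero (κ : Measure ℝ) (c : NNReal) (σ₁ σ₂ : Measure ℝ) : Prop where
  add_eq : κ + σ₂ = c • volume.restrict (Set.Icc (-1) 1) + σ₁
  le_restrict : σ₂ ≤ c • volume.restrict (Set.Icc (-1) 1)
  tendsto_div : Tendsto (fun r => (σ₁ + σ₂) (Metric.closedBall 0 r) /
    volume (Metric.closedBall (0 : ℝ) r)) (𝓝[>] (0 : ℝ)) (𝓝 0)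

/-- A finite measure on the line has a density, in the strong sense, at almost every point. -/
theorem ae_exists_isLebesgueDensityAtZero (k : Measure ℝ) [IsFiniteMeasure k] :
    ∀ᵐ x : ℝ, ∃ c σ₁ σ₂, IsLebesgueDensityAtZero (k.map (· - x)) c σ₁ σ₂ := by
  set f := k.rnDeriv volume
  have hf : Measurable f := k.measurable_rnDeriv volume
  have hint : Integrable (fun x => (f x).toReal) volume := Measure.integrable_toReal_rnDeriv
  filter_upwards [Besicovitch.ae_tendsto_rnDeriv (k.singularPart volume) volume,
    k.rnDeriv_singularPart volume, k.rnDeriv_lt_top volume,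
    (Besicovitch.vitaliFamily (volume : Measure ℝ)).ae_tendsto_lintegral_enorm_sub_div_of_integrable
      hint] with x hx1 hx2 hx3 hx4
  replace hx4 := hx4.comp (Besicovitch.tendsto_filterAt volume x)
  rw [hx2] at hx1
  set c := (f x).toNNReal
  set i : ℝ → ENNReal := ((· - x) ⁻¹' Set.Icc (-1) 1).indicator fun _ => (c : ENNReal)
  have hB : MeasurableSet ((· - x) ⁻¹' Set.Icc (-1 : ℝ) 1) :=
    measurableSet_Icc.preimage (measurable_sub_const x)
  have hi : Measurable i := measurable_const.indicator hB
  set τ₁ := k.singularPart volume + volume.withDensity (fun t => f t - i t)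
  set τ₂ := volume.withDensity (fun t => i t - f t)
  have hmap : Measure.map (· - x) (volume.withDensity i) =
      c • volume.restrict (Set.Icc (-1) 1) := by
    rw [withDensity_indicator hB, withDensity_const, Measure.map_smul,
      ((measurePreserving_sub_right volume x).restrict_preimage measurableSet_Icc).map_eq]
    rfl
  refine ⟨c, τ₁.map (· - x), τ₂.map (· - x), ?_, ?_, ?_⟩
  · rw [← hmap, ← Measure.map_add _ _ (measurable_sub_const x),
      ← Measure.map_add _ _ (measurable_sub_const x)]
    congr 1
    conv_lhs => rw [← k.singularPart_add_rnDeriv volume]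
    simp only [τ₁, τ₂]
    rw [add_assoc, add_left_comm (volume.withDensity i), ← withDensity_add_left hf, ← withDensity_add_left hi]
    congr 2
    ext t
    simp only [Pi.add_apply]
    rw [add_tsub_eq_max, add_tsub_eq_max, max_comm]
  · rw [← hmap]
    refine Measure.map_mono (withDensity_mono (Eventually.of_forall fun t => tsub_le_self))
      (measurable_sub_const x)
  · have hsum := hx1.add hx4
    simp only [Pi.zero_apply, add_zero] at hsum
    refine tendsto_of_tendsto_of_tendsto_of_le_of_le' tendsto_const_nhds hsum
      (Eventually.of_forall fun _ => zero_le) ?_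
    filter_upwards [Ioo_mem_nhdsGT one_pos] with r hr
    have hpre : (· - x) ⁻¹' Metric.closedBall 0 r = Metric.closedBall x r := by
      ext t; simp [Real.dist_eq]
    have hvol : volume (Metric.closedBall (0 : ℝ) r) = volume (Metric.closedBall x r) := by simp
    rw [Function.comp_apply, hvol, ← ENNReal.add_div, ← Measure.map_add _ _ (measurable_sub_const x),
      Measure.map_apply (measurable_sub_const x) measurableSet_closedBall, hpre]
    gcongr
    simp only [τ₁, τ₂, Measure.add_apply, add_assoc]
    gcongr
    rw [withDensity_apply _ measurableSet_closedBall, withDensity_apply _ measurableSet_closedBall,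
      ← lintegral_add_left (by fun_prop)]
    refine setLIntegral_mono_ae' measurableSet_closedBall ?_
    filter_upwards [k.rnDeriv_lt_top volume] with t ht htr
    have hti : i t = c := by
      refine Set.indicator_of_mem ?_ _
      rw [Metric.mem_closedBall, Real.dist_eq] at htr
      have := abs_le.1 (htr.trans hr.2.le)
      exact ⟨by linarith, by linarith⟩
    rw [hti]
    obtain ⟨a, ha⟩ : ∃ a : NNReal, (a : ENNReal) = f t :=
      ⟨(f t).toNNReal, ENNReal.coe_toNNReal ht.ne⟩
    have hca : (f x).toReal = c := rfl
    rw [hca, ← ha, ENNReal.coe_toReal, Real.enorm_eq_ofReal_abs]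
    rcases le_total a c with h | h
    · rw [abs_of_nonpos (by simpa using h), neg_sub, ENNReal.ofReal_sub _ a.coe_nonneg,
        tsub_eq_zero_of_le (by exact_mod_cast h)]
      simp
    · rw [abs_of_nonneg (by simpa using h), ENNReal.ofReal_sub _ c.coe_nonneg,
        tsub_eq_zero_of_le (a := (c : ENNReal)) (by exact_mod_cast h)]
      simp

/-- The logarithmic kernel at scale `h`. -/
noncomputable def logKernel (h s : ℝ) : ℝ := Real.log (1 + (h / s) ^ 2)

theorem logKernel_nonneg (h s : ℝ) : 0 ≤ logKernel h s :=
  Real.log_nonneg (by nlinarith [sq_nonneg (h / s)])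

theorem measurable_logKernel (h : ℝ) : Measurable (logKernel h) := by
  unfold logKernel
  fun_prop

theorem logKernel_le (h s : ℝ) : logKernel h s ≤ (h / s) ^ 2 := by
  have := Real.log_le_sub_one_of_pos (show 0 < 1 + (h / s) ^ 2 by positivity)
  unfold logKernel
  linarith

theorem logKernel_anti (h : ℝ) {s t : ℝ} (hs : s ≠ 0) (hst : |s| ≤ |t|) :
    logKernel h t ≤ logKernel h s := by
  unfold logKernel
  refine Real.log_le_log (by positivity) ?_
  rw [div_pow, div_pow]
  have h1 : s ^ 2 ≤ t ^ 2 := sq_le_sq.2 hst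
  have h2 : 0 < s ^ 2 := by positivity
  gcongr

theorem integrable_logKernel_one : Integrable (logKernel 1) := by
  have hlog : IntegrableOn (fun u : ℝ => Real.log 2 + 2 * |Real.log u|) (Set.Icc (-1) 1) := by
    have h1 : IntegrableOn Real.log (Set.Icc (-1) 1) := by
      rw [integrableOn_Icc_iff_integrableOn_Ioc,
        ← intervalIntegrable_iff_integrableOn_Ioc_of_le (by norm_num)]
      exact intervalIntegral.intervalIntegrable_log'
    have h2 : IntegrableOn (fun _ : ℝ => Real.log 2) (Set.Icc (-1) 1) :=
      integrableOn_const (by simp)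
    exact h2.add (h1.abs.const_mul 2)
  refine Integrable.mono' ((integrable_inv_one_add_sq.const_mul 2).add
    (hlog.integrable_indicator measurableSet_Icc)) (measurable_logKernel 1).aestronglyMeasurable ?_
  have h0 : ∀ᵐ u : ℝ, u ≠ 0 := by simp [ae_iff]
  filter_upwards [h0] with u hu
  rw [Real.norm_of_nonneg (logKernel_nonneg 1 u), Pi.add_apply]
  by_cases hu1 : u ∈ Set.Icc (-1 : ℝ) 1
  · rw [Set.indicator_of_mem hu1]
    have h1 : (1 : ℝ) + (1 / u) ^ 2 = (1 + u ^ 2) / u ^ 2 := by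
      field_simp
      ring
    have h2 : Real.log (1 + u ^ 2) ≤ Real.log 2 :=
      Real.log_le_log (by positivity) (by nlinarith [hu1.1, hu1.2])
    have h3 := neg_abs_le (Real.log u)
    have h4 : 0 ≤ 2 * (1 + u ^ 2)⁻¹ := by positivity
    rw [logKernel, h1, Real.log_div (by positivity) (by positivity), Real.log_pow]
    push_cast
    linarith
  · rw [Set.indicator_of_notMem hu1, add_zero]
    refine (logKernel_le 1 u).trans ?_
    have h1 : 1 < |u| := by
      by_contra! h
      exact hu1 (abs_le.1 h)
    have h2 : 1 < u ^ 2 := by nlinarith [sq_abs u]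
    rw [div_pow, one_pow, ← div_eq_mul_inv, div_le_div_iff₀ (by positivity) (by positivity)]
    linarith

theorem logKernel_eq_div (h s : ℝ) : logKernel h s = logKernel 1 (s / h) := by
  rw [logKernel, logKernel, one_div_div]

theorem integrable_logKernel {h : ℝ} (hh : 0 < h) : Integrable (logKernel h) := by
  rw [show logKernel h = fun s => logKernel 1 (s / h) from funext (logKernel_eq_div h)]
  exact integrable_logKernel_one.comp_div hh.ne'

theorem integral_logKernel {h : ℝ} (hh : 0 < h) :
    ∫ s, logKernel h s = h * ∫ s, logKernel 1 s := by
  rw [show logKernel h = fun s => logKernel 1 (s / h) from funext (logKernel_eq_div h),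
    Measure.integral_comp_div, abs_of_pos hh, smul_eq_mul]

theorem lintegral_logKernel {h : ℝ} (hh : 0 < h) :
    ∫⁻ s, ENNReal.ofReal (logKernel h s) = ENNReal.ofReal (h * ∫ s, logKernel 1 s) := by
  rw [← integral_logKernel hh, ofReal_integral_eq_lintegral_ofReal (integrable_logKernel hh)
    (Eventually.of_forall (logKernel_nonneg h))]

theorem measure_singleton_zero_of_closedBall_le {σ : Measure ℝ} {δ : NNReal} {r₀ : ℝ}
    (hr₀ : 0 < r₀) (hσ : ∀ r, 0 < r → r ≤ r₀ → σ (Metric.closedBall 0 r) ≤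
      δ * volume (Metric.closedBall (0 : ℝ) r)) : σ {0} = 0 := by
  have h1 : Tendsto (fun r : ℝ => (δ : ENNReal) * volume (Metric.closedBall (0 : ℝ) r)) (𝓝[>] 0)
      (𝓝 0) := by
    simp only [Real.volume_closedBall]
    have h2 : Tendsto (fun r : ℝ => ENNReal.ofReal (2 * r)) (𝓝[>] 0) (𝓝 0) := by
      refine tendsto_nhdsWithin_of_tendsto_nhds (Continuous.tendsto' ?_ _ _ (by simp))
      exact ENNReal.continuous_ofReal.comp (by fun_prop)
    simpa using ENNReal.Tendsto.const_mul h2 (Or.inr ENNReal.coe_ne_top)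
  refine le_antisymm (ge_of_tendsto h1 ?_) zero_le
  filter_upwards [Ioc_mem_nhdsGT hr₀] with r hr
  refine le_trans (measure_mono ?_) (hσ r hr.1 hr.2)
  simpa using hr.1.le

/-- If centred intervals have small measure relative to Lebesgue measure, then so do
radially decreasing functions. -/
theorem setLIntegral_le_of_radially_antitone {σ : Measure ℝ} {δ : NNReal} {r₀ : ℝ}
    (hr₀ : 0 < r₀) (hσ : ∀ r, 0 < r → r ≤ r₀ → σ (Metric.closedBall 0 r) ≤
      δ * volume (Metric.closedBall (0 : ℝ) r)) {φ : ℝ → ℝ} (hφm : Measurable φ)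
    (hφ0 : ∀ s, 0 ≤ φ s) (hφ : ∀ s t, s ≠ 0 → |s| ≤ |t| → φ t ≤ φ s) :
    ∫⁻ s in Metric.closedBall 0 r₀, ENNReal.ofReal (φ s) ∂σ ≤
      δ * ∫⁻ s, ENNReal.ofReal (φ s) := by
  rw [lintegral_eq_lintegral_meas_lt _ (Eventually.of_forall hφ0) hφm.aemeasurable,
    lintegral_eq_lintegral_meas_lt _ (Eventually.of_forall hφ0) hφm.aemeasurable,
    ← lintegral_const_mul' _ _ ENNReal.coe_ne_top]
  refine lintegral_mono fun u => ?_
  have hms : MeasurableSet {s | u < φ s} := measurableSet_lt measurable_const hφm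
  rw [Measure.restrict_apply hms]
  set A := {s | u < φ s} ∩ Metric.closedBall 0 r₀
  rcases A.eq_empty_or_nonempty with hA | hA
  · simp [hA]
  have hA₀ : ∀ s ∈ A, |s| ≤ r₀ := fun s hs => by simpa using hs.2
  set r := sSup ((|·|) '' A)
  have hbdd : BddAbove ((|·|) '' A) := ⟨r₀, by rintro _ ⟨s, hs, rfl⟩; exact hA₀ s hs⟩
  have hAr : A ⊆ Metric.closedBall 0 r := fun s hs => by
    simpa using le_csSup hbdd (Set.mem_image_of_mem _ hs)
  have hr : r ≤ r₀ := csSup_le (hA.image _) (by rintro _ ⟨s, hs, rfl⟩; exact hA₀ s hs)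
  rcases le_or_gt r 0 with hr0 | hr0
  · have hA0 : A ⊆ {0} := fun s hs => by
      have := hAr hs
      rw [Metric.mem_closedBall, dist_zero_right, Real.norm_eq_abs] at this
      exact abs_nonpos_iff.1 (this.trans hr0)
    rw [measure_mono_null hA0 (measure_singleton_zero_of_closedBall_le hr₀ hσ)]
    exact zero_le
  · refine (measure_mono hAr).trans ((hσ r hr0 hr).trans ?_)
    refine mul_le_mul' le_rfl ?_
    calc volume (Metric.closedBall (0 : ℝ) r) = volume (Metric.ball (0 : ℝ) r) := by simp
      _ = volume (Metric.ball (0 : ℝ) r \ {0}) := (measure_sdiff_null (by simp)).symm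
      _ ≤ _ := by
        refine measure_mono ?_
        rintro s ⟨hs, hs0⟩
        rw [Metric.mem_ball, dist_zero_right, Real.norm_eq_abs] at hs
        obtain ⟨_, ⟨t, ht, rfl⟩, hst⟩ := exists_lt_of_lt_csSup (hA.image _) hs
        exact lt_of_lt_of_le ht.1 (hφ s t hs0 hst.le)

theorem exists_closedBall_le_of_tendsto {σ : Measure ℝ}
    (hσ : Tendsto (fun r => σ (Metric.closedBall 0 r) / volume (Metric.closedBall (0 : ℝ) r))
      (𝓝[>] (0 : ℝ)) (𝓝 0)) {δ : NNReal} (hδ : 0 < δ) :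
    ∃ r₀ > 0, ∀ r, 0 < r → r ≤ r₀ → σ (Metric.closedBall 0 r) ≤
      δ * volume (Metric.closedBall (0 : ℝ) r) := by
  have h1 := hσ.eventually_le_const (u := (δ : ENNReal)) (by simpa using hδ)
  obtain ⟨r₀, hr₀, h2⟩ := mem_nhdsGT_iff_exists_Ioc_subset.1 h1
  refine ⟨r₀, hr₀, fun r hr hr' => ?_⟩
  have h3 : σ (Metric.closedBall 0 r) / volume (Metric.closedBall (0 : ℝ) r) ≤ δ := h2 ⟨hr, hr'⟩
  rwa [ENNReal.div_le_iff (by simpa using hr)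
    measure_closedBall_lt_top.ne] at h3

/-- A finite measure of density zero at `0` gives mass `o(h)` to the logarithmic kernel. -/
theorem eventually_lintegral_logKernel_le {σ : Measure ℝ} [IsFiniteMeasure σ]
    (hσ : Tendsto (fun r => σ (Metric.closedBall 0 r) / volume (Metric.closedBall (0 : ℝ) r))
      (𝓝[>] (0 : ℝ)) (𝓝 0)) {ε : ℝ} (hε : 0 < ε) :
    ∀ᶠ h in 𝓝[>] (0 : ℝ), ∫⁻ s, ENNReal.ofReal (logKernel h s) ∂σ ≤ ENNReal.ofReal (ε * h) := by
  set A := ∫ s, logKernel 1 s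
  have hA : 0 ≤ A := integral_nonneg (logKernel_nonneg 1)
  set δ : NNReal := ⟨ε / (2 * (A + 1)), by positivity⟩
  have hδ : 0 < δ := show 0 < ε / (2 * (A + 1)) by positivity
  obtain ⟨r₀, hr₀, hball⟩ := exists_closedBall_le_of_tendsto hσ hδ
  set m := σ.real Set.univ
  have hm : 0 ≤ m := measureReal_nonneg
  have hη : 0 < ε * r₀ ^ 2 / (2 * (m + 1)) := by positivity
  filter_upwards [Ioo_mem_nhdsGT hη] with h hh
  have hh0 : 0 < h := hh.1
  rw [← lintegral_add_compl _ (measurableSet_closedBall (x := (0 : ℝ)) (ε := r₀))]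
  have h1 : ∫⁻ s in Metric.closedBall 0 r₀, ENNReal.ofReal (logKernel h s) ∂σ ≤
      ENNReal.ofReal (ε / 2 * h) := by
    refine (setLIntegral_le_of_radially_antitone hr₀ hball (measurable_logKernel h)
      (logKernel_nonneg h) fun s t => logKernel_anti h).trans ?_
    rw [lintegral_logKernel hh0, ← ENNReal.ofReal_coe_nnreal, ← ENNReal.ofReal_mul δ.coe_nonneg]
    apply ENNReal.ofReal_le_ofReal
    change ε / (2 * (A + 1)) * (h * A) ≤ ε / 2 * h
    rw [div_mul_eq_mul_div, div_le_iff₀ (by positivity)]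
    nlinarith [mul_pos hε hh0]
  have h2 : ∫⁻ s in (Metric.closedBall 0 r₀)ᶜ, ENNReal.ofReal (logKernel h s) ∂σ ≤
      ENNReal.ofReal (ε / 2 * h) := by
    calc _ ≤ ∫⁻ s in (Metric.closedBall 0 r₀)ᶜ, ENNReal.ofReal ((h / r₀) ^ 2) ∂σ := by
          refine setLIntegral_mono measurable_const fun s hs => ENNReal.ofReal_le_ofReal ?_
          rw [Set.mem_compl_iff, Metric.mem_closedBall, dist_zero_right, Real.norm_eq_abs,
            not_le] at hs
          refine (logKernel_le h s).trans ?_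
          rw [div_pow, div_pow]
          have : r₀ ^ 2 ≤ s ^ 2 := by rw [← sq_abs s]; gcongr
          gcongr
      _ ≤ ENNReal.ofReal ((h / r₀) ^ 2) * σ Set.univ := by
          rw [lintegral_const, Measure.restrict_apply_univ]
          gcongr
          exact Set.subset_univ _
      _ = ENNReal.ofReal ((h / r₀) ^ 2 * m) := by
          rw [ENNReal.ofReal_mul (by positivity), ofReal_measureReal]
      _ ≤ _ := by
          apply ENNReal.ofReal_le_ofReal
          have h3 : h * (2 * (m + 1)) < ε * r₀ ^ 2 := (lt_div_iff₀ (by positivity)).1 hh.2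
          rw [div_pow, div_mul_eq_mul_div, div_le_iff₀ (by positivity)]
          nlinarith
  refine (add_le_add h1 h2).trans (le_of_eq ?_)
  rw [← ENNReal.ofReal_add (by positivity) (by positivity)]
  ring_nf

namespace IsLebesgueDensityAtZero

variable {κ σ₁ σ₂ : Measure ℝ} {c : NNReal}

theorem isFiniteMeasure_add [IsFiniteMeasure κ] (hκ : IsLebesgueDensityAtZero κ c σ₁ σ₂) :
    IsFiniteMeasure (σ₁ + σ₂) := by
  have h2 : IsFiniteMeasure σ₂ := isFiniteMeasure_of_le _ hκ.le_restrict
  have h1 : IsFiniteMeasure σ₁ :=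
    isFiniteMeasure_of_le (κ + σ₂) (hκ.add_eq ▸ Measure.le_add_left le_rfl)
  infer_instance

theorem le_add (hκ : IsLebesgueDensityAtZero κ c σ₁ σ₂) :
    κ ≤ c • volume.restrict (Set.Icc (-1) 1) + σ₁ :=
  hκ.add_eq ▸ Measure.le_add_right le_rfl

theorem add_singleton_zero (hκ : IsLebesgueDensityAtZero κ c σ₁ σ₂) : (σ₁ + σ₂) {0} = 0 := by
  obtain ⟨r₀, hr₀, hr⟩ := exists_closedBall_le_of_tendsto hκ.tendsto_div one_pos
  exact measure_singleton_zero_of_closedBall_le hr₀ hr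

theorem singleton_zero (hκ : IsLebesgueDensityAtZero κ c σ₁ σ₂) : κ {0} = 0 := by
  refine le_antisymm ((hκ.le_add _).trans ?_) zero_le
  have h1 : σ₁ {0} ≤ 0 := (Measure.le_add_right le_rfl _).trans hκ.add_singleton_zero.le
  have h2 : (volume.restrict (Set.Icc (-1 : ℝ) 1)) {0} = 0 :=
    le_antisymm ((Measure.restrict_le_self _).trans (by simp)) zero_le
  simpa [h2] using h1

theorem ae_ne_zero (hκ : IsLebesgueDensityAtZero κ c σ₁ σ₂) : ∀ᵐ s ∂(σ₁ + σ₂), s ≠ 0 :=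
  compl_mem_ae_iff.2 hκ.add_singleton_zero

theorem integrable (hκ : IsLebesgueDensityAtZero κ c σ₁ σ₂) {K : ℝ → ℝ}
    (hK : IntegrableOn K (Set.Icc (-1) 1)) (hKσ : Integrable K (σ₁ + σ₂)) : Integrable K κ :=
  (hK.smul_measure_nnreal.add_measure
    (hKσ.mono_measure (Measure.le_add_right le_rfl))).mono_measure hκ.le_add

theorem abs_integral_sub_le (hκ : IsLebesgueDensityAtZero κ c σ₁ σ₂) {K : ℝ → ℝ}
    (hK : IntegrableOn K (Set.Icc (-1) 1)) (hKσ : Integrable K (σ₁ + σ₂)) :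
    |∫ s, K s ∂κ - c * ∫ s in Set.Icc (-1) 1, K s| ≤ ∫ s, |K s| ∂(σ₁ + σ₂) := by
  have hK1 : Integrable K σ₁ := hKσ.mono_measure (Measure.le_add_right le_rfl)
  have hK2 : Integrable K σ₂ := hKσ.mono_measure (Measure.le_add_left le_rfl)
  have h1 : ∫ s, K s ∂(κ + σ₂) = ∫ s, K s ∂(c • volume.restrict (Set.Icc (-1) 1) + σ₁) := by
    rw [hκ.add_eq]
  rw [integral_add_measure (hκ.integrable hK hKσ) hK2,
    integral_add_measure hK.smul_measure_nnreal hK1, integral_smul_nnreal_measure] at h1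
  rw [integral_add_measure hK1.abs hK2.abs]
  have h2 : |∫ s, K s ∂σ₁| ≤ ∫ s, |K s| ∂σ₁ := abs_integral_le_integral_abs
  have h3 : |∫ s, K s ∂σ₂| ≤ ∫ s, |K s| ∂σ₂ := abs_integral_le_integral_abs
  have h4 : c • ∫ s in Set.Icc (-1) 1, K s = c * ∫ s in Set.Icc (-1) 1, K s := rfl
  rw [h4] at h1
  rw [abs_le] at *
  constructor <;> linarith [h2.1, h2.2, h3.1, h3.2]

theorem eventually_integrable_logKernel [IsFiniteMeasure κ]
    (hκ : IsLebesgueDensityAtZero κ c σ₁ σ₂) {ε : ℝ} (hε : 0 < ε) :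
    ∀ᶠ h in 𝓝[>] (0 : ℝ), Integrable (logKernel h) (σ₁ + σ₂) ∧
      ∫ s, logKernel h s ∂(σ₁ + σ₂) ≤ ε * h := by
  have := hκ.isFiniteMeasure_add
  filter_upwards [eventually_lintegral_logKernel_le hκ.tendsto_div hε, self_mem_nhdsWithin]
    with h hh hh0
  have hh0 : 0 < h := hh0
  have h1 : Integrable (logKernel h) (σ₁ + σ₂) :=
    (lintegral_ofReal_ne_top_iff_integrable (measurable_logKernel h).aestronglyMeasurable
      (Eventually.of_forall (logKernel_nonneg h))).1 (hh.trans_lt ENNReal.ofReal_lt_top).ne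
  refine ⟨h1, ?_⟩
  rwa [← ofReal_integral_eq_lintegral_ofReal h1 (Eventually.of_forall (logKernel_nonneg h)),
    ENNReal.ofReal_le_ofReal_iff (by positivity)] at hh

end IsLebesgueDensityAtZero

theorem sq_div_le_logKernel (h : ℝ) {s : ℝ} (hs : s ≠ 0) :
    h ^ 2 / (s ^ 2 + h ^ 2) ≤ logKernel h s := by
  have h1 := Real.one_sub_inv_le_log_of_pos (show 0 < 1 + (h / s) ^ 2 by positivity)
  refine le_trans (le_of_eq ?_) h1
  field_simp
  ring

theorem continuous_poissonKernel {h : ℝ} (hh : h ≠ 0) :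
    Continuous fun s : ℝ => h / (s ^ 2 + h ^ 2) :=
  continuous_const.div (by fun_prop) fun s => by positivity

theorem setIntegral_poissonKernel {h : ℝ} (hh : 0 < h) :
    ∫ s in Set.Icc (-1 : ℝ) 1, h / (s ^ 2 + h ^ 2) = 2 * Real.arctan h⁻¹ := by
  rw [integral_Icc_eq_integral_Ioc, ← intervalIntegral.integral_of_le (by norm_num)]
  have : ∀ s : ℝ, h / (s ^ 2 + h ^ 2) = h⁻¹ * (1 / (1 + (s / h) ^ 2)) := fun s => by
    field_simp
    ring
  simp_rw [this]
  rw [intervalIntegral.integral_const_mul,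
    intervalIntegral.integral_comp_div (fun s => 1 / (1 + s ^ 2)) hh.ne',
    integral_one_div_one_add_sq, neg_div, Real.arctan_neg, smul_eq_mul, one_div]
  field_simp
  ring

/-- Fatou's theorem for the Poisson integral: it tends to `π` times the density. -/
theorem IsLebesgueDensityAtZero.tendsto_integral_poissonKernel {κ σ₁ σ₂ : Measure ℝ} {c : NNReal}
    [IsFiniteMeasure κ] (hκ : IsLebesgueDensityAtZero κ c σ₁ σ₂) :
    Tendsto (fun h : ℝ => ∫ s, h / (s ^ 2 + h ^ 2) ∂κ) (𝓝[>] 0) (𝓝 (c * Real.pi)) := by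
  have h1 : Tendsto (fun h : ℝ => c * (2 * Real.arctan h⁻¹)) (𝓝[>] 0) (𝓝 (c * Real.pi)) := by
    have h2 : Tendsto (fun h : ℝ => Real.arctan h⁻¹) (𝓝[>] 0) (𝓝 (Real.pi / 2)) :=
      (Real.tendsto_arctan_atTop.mono_right nhdsWithin_le_nhds).comp
      (tendsto_inv_nhdsGT_zero (𝕜 := ℝ))
    rw [show (c : ℝ) * Real.pi = c * (2 * (Real.pi / 2)) by ring]
    exact (h2.const_mul 2).const_mul (c : ℝ)
  refine h1.congr_dist ?_
  rw [Metric.tendsto_nhds]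
  intro ε hε
  filter_upwards [hκ.eventually_integrable_logKernel (half_pos hε), self_mem_nhdsWithin]
    with h hh hh0
  have hh0 : 0 < h := hh0
  have h3 : ∀ᵐ s ∂(σ₁ + σ₂), |h / (s ^ 2 + h ^ 2)| ≤ h⁻¹ * logKernel h s := by
    filter_upwards [hκ.ae_ne_zero] with s hs
    rw [abs_of_nonneg (by positivity)]
    calc h / (s ^ 2 + h ^ 2) = h⁻¹ * (h ^ 2 / (s ^ 2 + h ^ 2)) := by field_simp
      _ ≤ _ := by gcongr; exact sq_div_le_logKernel h hs
  have hc := continuous_poissonKernel hh0.ne'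
  have h4 : Integrable (fun s : ℝ => h / (s ^ 2 + h ^ 2)) (σ₁ + σ₂) :=
    (hh.1.const_mul h⁻¹).mono' hc.aestronglyMeasurable h3
  have h5 := hκ.abs_integral_sub_le (hc.integrableOn_Icc) h4
  have h6 : ∫ s, |h / (s ^ 2 + h ^ 2)| ∂(σ₁ + σ₂) ≤ ε / 2 := by
    calc _ ≤ ∫ s, h⁻¹ * logKernel h s ∂(σ₁ + σ₂) :=
          integral_mono_ae h4.abs (hh.1.const_mul _) h3
      _ ≤ h⁻¹ * (ε / 2 * h) := by
          rw [integral_const_mul]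
          gcongr
          exact hh.2
      _ = ε / 2 := by field_simp
  rw [setIntegral_poissonKernel hh0] at h5
  rw [Real.dist_eq, Real.dist_eq, sub_zero, abs_abs, abs_sub_comm]
  linarith

theorem abs_log_le (u : ℝ) (hu : u ≠ 0) : |Real.log u| ≤ logKernel 1 u / 2 + |u| := by
  have h1 : (1 : ℝ) + (1 / u) ^ 2 = (1 + u ^ 2) / u ^ 2 := by
    field_simp
    ring
  have h2 : logKernel 1 u = Real.log (1 + u ^ 2) - 2 * Real.log u := by
    rw [logKernel, h1, Real.log_div (by positivity) (by positivity), Real.log_pow]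
    norm_num
  have h3 : 0 ≤ Real.log (1 + u ^ 2) := Real.log_nonneg (by nlinarith [sq_nonneg u])
  have h4 := Real.log_le_sub_one_of_pos (abs_pos.2 hu)
  rw [Real.log_abs] at h4
  have h5 := logKernel_nonneg 1 u
  rw [abs_le]
  constructor <;> linarith [abs_nonneg u]

theorem IsLebesgueDensityAtZero.integrable_log {κ σ₁ σ₂ : Measure ℝ} {c : NNReal}
    [IsFiniteMeasure κ] (hκ : IsLebesgueDensityAtZero κ c σ₁ σ₂)
    (hint : Integrable (fun s : ℝ => |s|) κ) : Integrable Real.log κ := by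
  obtain ⟨h, hh, hh0⟩ :=
    ((hκ.eventually_integrable_logKernel one_pos).and self_mem_nhdsWithin).exists
  have hh0 : 0 < h := hh0
  have h1 : Integrable (logKernel h) κ :=
    hκ.integrable (integrable_logKernel hh0).integrableOn hh.1
  refine (((integrable_const |Real.log h|).add (h1.div_const 2)).add
    (hint.div_const h)).mono' Real.measurable_log.aestronglyMeasurable ?_
  filter_upwards [compl_mem_ae_iff.2 hκ.singleton_zero] with s hs
  have hs : s ≠ 0 := hs
  have h2 := abs_log_le (s / h) (by positivity)
  rw [Real.log_div hs hh0.ne', ← logKernel_eq_div, abs_div, abs_of_pos hh0] at h2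
  have h3 := abs_sub_abs_le_abs_sub (Real.log s) (Real.log h)
  simp only [Pi.add_apply, Real.norm_eq_abs]
  linarith

theorem abs_log_sub_sub_log_add_le_of_scale_one {u v : ℝ} (hu : u ≠ 0) (huv : u - v ≠ 0)
    (hv : |v| < 1) :
    |Real.log (u - v) - Real.log u + v * (u / (u ^ 2 + 1))| ≤
      31 * logKernel 1 u +
        (Metric.closedBall 0 2).indicator (fun u => logKernel 1 (u - v)) u := by
  have hker := sq_div_le_logKernel 1 hu
  have hvv := abs_lt.1 hv
  have hu2 : 0 < u ^ 2 := by positivity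
  by_cases h : u ∈ Metric.closedBall (0 : ℝ) 2
  · rw [Set.indicator_of_mem h]
    rw [Metric.mem_closedBall, dist_zero_right, Real.norm_eq_abs] at h
    have huu := abs_le.1 h
    have h1 := abs_log_le u hu
    have h2 := abs_log_le (u - v) huv
    have h3 : |u - v| ≤ 3 := (abs_sub _ _).trans (by linarith)
    have h4 : |v * (u / (u ^ 2 + 1))| ≤ 1 := by
      rw [abs_mul, abs_div, abs_of_pos (show 0 < u ^ 2 + 1 by positivity)]
      have : |u| / (u ^ 2 + 1) ≤ 1 := by
        rw [div_le_one (by positivity), ← sq_abs]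
        nlinarith [sq_nonneg (|u| - 1)]
      have h0 : 0 ≤ |u| / (u ^ 2 + 1) := by positivity
      nlinarith [abs_nonneg v]
    have h5 : 1 / 5 ≤ 1 ^ 2 / (u ^ 2 + 1 ^ 2) := by
      rw [div_le_div_iff₀ (by norm_num) (by positivity)]
      nlinarith
    have h6 := logKernel_nonneg 1 (u - v)
    rw [abs_le] at h1 h2 h4 ⊢
    constructor <;> linarith
  · rw [Set.indicator_of_notMem h, add_zero]
    rw [Metric.mem_closedBall, dist_zero_right, Real.norm_eq_abs, not_le] at h
    have hw : |v / u| ≤ 1 / 2 := by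
      rw [abs_div, div_le_div_iff₀ (by positivity) (by norm_num)]
      linarith
    have h1 := Real.abs_log_sub_add_sum_range_le (hw.trans_lt (by norm_num)) 1
    norm_num at h1
    have h2 : Real.log (u - v) - Real.log u = Real.log (1 - v / u) := by
      rw [← Real.log_div huv hu, sub_div, div_self hu]
    have h3 : |v / u| ^ 2 / (1 - |v / u|) ≤ 2 * (1 / u ^ 2) := by
      rw [div_le_iff₀ (by linarith)]
      have h4 : |v / u| ^ 2 ≤ 1 / u ^ 2 := by
        rw [sq_abs, div_pow]
        gcongr
        rw [← sq_abs]
        nlinarith [abs_nonneg v]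
      have h5 : 0 < 1 / u ^ 2 := by positivity
      nlinarith
    have hu4 : 4 < u ^ 2 := by
      rw [← sq_abs]
      nlinarith
    have h4 : |v * (u / (u ^ 2 + 1)) - v / u| ≤ 1 / u ^ 2 := by
      have : v * (u / (u ^ 2 + 1)) - v / u = -(v / u) / (u ^ 2 + 1) := by
        field_simp
        ring
      rw [this, abs_div, abs_neg, abs_of_pos (show 0 < u ^ 2 + 1 by positivity)]
      apply div_le_div₀ (by norm_num) (by linarith) (by positivity) (by linarith)
    have h5 : 4 / 5 * (1 / u ^ 2) ≤ 1 ^ 2 / (u ^ 2 + 1 ^ 2) := by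
      rw [show 4 / 5 * (1 / u ^ 2) = 4 / (5 * u ^ 2) by field_simp, div_le_div_iff₀ (by positivity) (by positivity)]
      nlinarith
    rw [sq_abs] at h3
    rw [h2]
    have h6 : 0 ≤ logKernel 1 u := logKernel_nonneg 1 u
    have h7 := abs_add_le (v / u + Real.log (1 - v / u)) (v * (u / (u ^ 2 + 1)) - v / u)
    rw [show v / u + Real.log (1 - v / u) + (v * (u / (u ^ 2 + 1)) - v / u) =
      Real.log (1 - v / u) + v * (u / (u ^ 2 + 1)) by ring] at h7
    linarith

/-- The second-order difference of the logarithm is controlled by the logarithmic kernel. -/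
theorem abs_log_sub_sub_log_add_le {h y s : ℝ} (hh : 0 < h) (hy : |y| < h) (hs : s ≠ 0)
    (hsy : s ≠ y) :
    |Real.log (s - y) - Real.log s + y * (s / (s ^ 2 + h ^ 2))| ≤
      31 * logKernel h s +
        (Metric.closedBall 0 (2 * h)).indicator (fun s => logKernel h (s - y)) s := by
  have hsy' : s - y ≠ 0 := sub_ne_zero.2 hsy
  have h1 := abs_log_sub_sub_log_add_le_of_scale_one (u := s / h) (v := y / h) (by positivity)
    (by rw [← sub_div]; positivity) (by rwa [abs_div, abs_of_pos hh, div_lt_one hh])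
  have h2 : s / h ∈ Metric.closedBall (0 : ℝ) 2 ↔ s ∈ Metric.closedBall (0 : ℝ) (2 * h) := by
    simp [abs_of_pos hh, div_le_iff₀ hh]
  have h3 : y / h * (s / h / ((s / h) ^ 2 + 1)) = y * (s / (s ^ 2 + h ^ 2)) := by
    field_simp
  rw [← sub_div, Real.log_div hsy' hh.ne', Real.log_div hs hh.ne', ← logKernel_eq_div, h3] at h1
  have h4 : Real.log (s - y) - Real.log h - (Real.log s - Real.log h) =
      Real.log (s - y) - Real.log s := by ring
  rw [h4] at h1
  refine h1.trans_eq ?_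
  by_cases hmem : s ∈ Metric.closedBall (0 : ℝ) (2 * h)
  · rw [Set.indicator_of_mem hmem, Set.indicator_of_mem (h2.2 hmem), ← sub_div,
      ← logKernel_eq_div]
  · rw [Set.indicator_of_notMem hmem, Set.indicator_of_notMem (mt h2.1 hmem)]

theorem integral_Icc_log_sub (y : ℝ) : ∫ s in Set.Icc (-1 : ℝ) 1, Real.log (s - y) =
    (1 - y) * Real.log (1 - y) + (1 + y) * Real.log (1 + y) - 2 := by
  rw [integral_Icc_eq_integral_Ioc, ← intervalIntegral.integral_of_le (by norm_num),
    intervalIntegral.integral_comp_sub_right, integral_log,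
    show -1 - y = -(1 + y) by ring, Real.log_neg_eq_log]
  ring

theorem integrableOn_Icc_log_sub (y : ℝ) :
    IntegrableOn (fun s => Real.log (s - y)) (Set.Icc (-1) 1) := by
  rw [integrableOn_Icc_iff_integrableOn_Ioc,
    ← intervalIntegrable_iff_integrableOn_Ioc_of_le (by norm_num)]
  have := (intervalIntegral.intervalIntegrable_log' (a := -1 - y) (b := 1 - y)).comp_sub_right y
  simpa using this

theorem integral_Icc_conjPoissonKernel (h : ℝ) :
    ∫ s in Set.Icc (-1 : ℝ) 1, s / (s ^ 2 + h ^ 2) = 0 := by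
  rw [integral_Icc_eq_integral_Ioc, ← intervalIntegral.integral_of_le (by norm_num)]
  have h1 := intervalIntegral.integral_comp_neg (a := -1) (b := 1)
    fun s : ℝ => s / (s ^ 2 + h ^ 2)
  simp only [neg_sq, neg_div, intervalIntegral.integral_neg, neg_neg] at h1
  linarith

theorem continuous_conjPoissonKernel {h : ℝ} (hh : h ≠ 0) :
    Continuous fun s : ℝ => s / (s ^ 2 + h ^ 2) :=
  continuous_id.div (by fun_prop) fun s => by positivity

theorem integrable_conjPoissonKernel {κ : Measure ℝ} [IsFiniteMeasure κ] {h : ℝ} (hh : 0 < h) :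
    Integrable (fun s : ℝ => s / (s ^ 2 + h ^ 2)) κ := by
  refine Integrable.of_bound (continuous_conjPoissonKernel hh.ne').aestronglyMeasurable h⁻¹
    (Eventually.of_forall fun s => ?_)
  rw [Real.norm_eq_abs, abs_div, abs_of_pos (show 0 < s ^ 2 + h ^ 2 by positivity),
    div_le_iff₀ (by positivity), inv_mul_eq_div, le_div_iff₀ hh, ← sq_abs s]
  nlinarith [sq_nonneg (|s| - h), abs_nonneg s]

theorem IsLebesgueDensityAtZero.abs_integral_log_sub_le {κ σ₁ σ₂ : Measure ℝ} {c : NNReal}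
    [IsFiniteMeasure κ] (hκ : IsLebesgueDensityAtZero κ c σ₁ σ₂) (hlog : Integrable Real.log κ)
    {h y a b : ℝ} (hh : 0 < h) (hyh : |y| < h) (hy : (σ₁ + σ₂) {y} = 0)
    (hL : Integrable (logKernel h) (σ₁ + σ₂)) (ha : ∫ s, logKernel h s ∂(σ₁ + σ₂) ≤ a)
    (hb : ∫⁻ s in Metric.closedBall 0 (2 * h), ENNReal.ofReal (logKernel h (s - y)) ∂(σ₁ + σ₂) <
      ENNReal.ofReal b) :
    |∫ s, Real.log (s - y) ∂κ - ∫ s, Real.log s ∂κ + y * ∫ s, s / (s ^ 2 + h ^ 2) ∂κ| ≤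
      c * |(1 - y) * Real.log (1 - y) + (1 + y) * Real.log (1 + y)| + (31 * a + b) := by
  set K : ℝ → ℝ := fun s => Real.log (s - y) - Real.log s + y * (s / (s ^ 2 + h ^ 2)) with hKdef
  set G : ℝ → ℝ := (Metric.closedBall 0 (2 * h)).indicator fun s => logKernel h (s - y)
  have hPcont := continuous_conjPoissonKernel hh.ne'
  have hGm : Measurable fun s => logKernel h (s - y) := (measurable_logKernel h).comp (by fun_prop)
  have hG0 : ∀ s, 0 ≤ logKernel h (s - y) := fun s => logKernel_nonneg _ _
  have hGon : IntegrableOn (fun s => logKernel h (s - y)) (Metric.closedBall 0 (2 * h))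
      (σ₁ + σ₂) :=
    (lintegral_ofReal_ne_top_iff_integrable hGm.aestronglyMeasurable
      (Eventually.of_forall hG0)).1 (hb.trans ENNReal.ofReal_lt_top).ne
  have hGi : Integrable G (σ₁ + σ₂) :=
    (integrable_indicator_iff measurableSet_closedBall).2 hGon
  have hGb : ∫ s, G s ∂(σ₁ + σ₂) ≤ b := by
    rw [integral_indicator measurableSet_closedBall]
    rw [← ofReal_integral_eq_lintegral_ofReal hGon (Eventually.of_forall hG0)] at hb
    exact (ENNReal.lt_ofReal_iff_toReal_lt ENNReal.ofReal_ne_top |>.1 hb).le.trans' (by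
      rw [ENNReal.toReal_ofReal (setIntegral_nonneg measurableSet_closedBall fun s _ => hG0 s)])
  have hKle : ∀ᵐ s ∂(σ₁ + σ₂), |K s| ≤ 31 * logKernel h s + G s := by
    filter_upwards [hκ.ae_ne_zero, compl_mem_ae_iff.2 hy] with s hs hsy
    exact abs_log_sub_sub_log_add_le hh hyh hs hsy
  have hKm : Measurable K :=
    ((Real.measurable_log.comp (by fun_prop)).sub Real.measurable_log).add
      (hPcont.measurable.const_mul y)
  have hKσ : Integrable K (σ₁ + σ₂) :=
    ((hL.const_mul 31).add hGi).mono' hKm.aestronglyMeasurable hKle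
  have hlog1 := integrableOn_Icc_log_sub y
  have hlog0 : IntegrableOn Real.log (Set.Icc (-1) 1) := by
    simpa using integrableOn_Icc_log_sub 0
  have hP : IntegrableOn (fun s : ℝ => y * (s / (s ^ 2 + h ^ 2))) (Set.Icc (-1) 1) :=
    (hPcont.const_mul y).integrableOn_Icc
  have hKI : IntegrableOn K (Set.Icc (-1) 1) := (hlog1.sub hlog0).add hP
  have hKκ := hκ.integrable hKI hKσ
  have hPκ : Integrable (fun s : ℝ => y * (s / (s ^ 2 + h ^ 2))) κ :=
    (integrable_conjPoissonKernel hh).const_mul y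
  have hlogy : Integrable (fun s => Real.log (s - y)) κ := by
    refine ((hKκ.add hlog).sub hPκ).congr (Eventually.of_forall fun s => ?_)
    simp only [hKdef, Pi.add_apply, Pi.sub_apply]
    ring
  have h1 : ∫ s, K s ∂κ =
      ∫ s, Real.log (s - y) ∂κ - ∫ s, Real.log s ∂κ + y * ∫ s, s / (s ^ 2 + h ^ 2) ∂κ := by
    have h2 : Integrable (fun s => Real.log (s - y) - Real.log s) κ := hlogy.sub hlog
    rw [integral_add h2 hPκ, integral_sub hlogy hlog, integral_const_mul]
  have h2 : ∫ s in Set.Icc (-1) 1, K s =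
      (1 - y) * Real.log (1 - y) + (1 + y) * Real.log (1 + y) := by
    have h3 := integral_Icc_log_sub 0
    simp only [sub_zero, add_zero, Real.log_one] at h3
    have h4 : IntegrableOn (fun s => Real.log (s - y) - Real.log s) (Set.Icc (-1) 1) :=
      hlog1.sub hlog0
    rw [integral_add h4 hP, integral_sub hlog1 hlog0, integral_const_mul,
      integral_Icc_conjPoissonKernel, integral_Icc_log_sub, h3]
    ring
  have h3 := hκ.abs_integral_sub_le hKI hKσ
  have h4 : ∫ s, |K s| ∂(σ₁ + σ₂) ≤ 31 * a + b := by
    refine (integral_mono_ae hKσ.abs ((hL.const_mul 31).add hGi) hKle).trans ?_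
    rw [integral_add' (hL.const_mul 31) hGi, integral_const_mul]
    linarith
  rw [h1, h2] at h3
  set D := ∫ s, Real.log (s - y) ∂κ - ∫ s, Real.log s ∂κ + y * ∫ s, s / (s ^ 2 + h ^ 2) ∂κ
  set p := (1 - y) * Real.log (1 - y) + (1 + y) * Real.log (1 + y)
  have h5 := abs_add_le (D - c * p) (c * p)
  rw [sub_add_cancel, abs_mul, NNReal.abs_eq] at h5
  linarith

theorem lintegral_setLIntegral_logKernel_sub {σ : Measure ℝ} [SFinite σ] {h : ℝ} (hh : 0 < h)
    (A : Set ℝ) :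
    ∫⁻ y, ∫⁻ s in A, ENNReal.ofReal (logKernel h (s - y)) ∂σ =
      ENNReal.ofReal (h * ∫ s, logKernel 1 s) * σ A := by
  have hm : Measurable (Function.uncurry fun y s : ℝ => ENNReal.ofReal (logKernel h (s - y))) :=
    ((measurable_logKernel h).comp (measurable_snd.sub measurable_fst)).ennreal_ofReal
  rw [lintegral_lintegral_swap hm.aemeasurable]
  have h1 : ∀ s : ℝ, ∫⁻ y, ENNReal.ofReal (logKernel h (s - y)) =
      ENNReal.ofReal (h * ∫ s, logKernel 1 s) := fun s => by
    rw [lintegral_sub_left_eq_self fun y => ENNReal.ofReal (logKernel h y), lintegral_logKernel hh]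
  simp_rw [h1]
  rw [lintegral_const, Measure.restrict_apply_univ]

/-- For a measure of density zero at `0`, the local logarithmic potential at scale `h` is small
outside a set of measure `o(h)`. -/
theorem eventually_volume_le_setLIntegral_logKernel_sub {σ : Measure ℝ} [SFinite σ]
    (hσ : Tendsto (fun r => σ (Metric.closedBall 0 r) / volume (Metric.closedBall (0 : ℝ) r))
      (𝓝[>] (0 : ℝ)) (𝓝 0)) {a δ : ℝ} (ha : 0 < a) (hδ : 0 < δ) :
    ∀ᶠ h in 𝓝[>] (0 : ℝ), volume {y | ENNReal.ofReal (a * h) ≤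
      ∫⁻ s in Metric.closedBall 0 (2 * h), ENNReal.ofReal (logKernel h (s - y)) ∂σ} ≤
        ENNReal.ofReal (δ * h) := by
  set A := ∫ s, logKernel 1 s
  have hA : 0 ≤ A := integral_nonneg (logKernel_nonneg 1)
  set η : NNReal := ⟨a * δ / (4 * (A + 1)), by positivity⟩
  have hη : 0 < η := show 0 < a * δ / (4 * (A + 1)) by positivity
  obtain ⟨r₀, hr₀, hball⟩ := exists_closedBall_le_of_tendsto hσ hη
  filter_upwards [Ioo_mem_nhdsGT (half_pos hr₀)] with h hh
  have hh0 : 0 < h := hh.1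
  have hm : Measurable fun y => ∫⁻ s in Metric.closedBall 0 (2 * h),
      ENNReal.ofReal (logKernel h (s - y)) ∂σ := by
    refine Measurable.lintegral_prod_right' (f := fun p : ℝ × ℝ =>
      ENNReal.ofReal (logKernel h (p.2 - p.1))) ?_
    exact ((measurable_logKernel h).comp (measurable_snd.sub measurable_fst)).ennreal_ofReal
  have h1 := mul_meas_ge_le_lintegral (μ := volume) hm (ENNReal.ofReal (a * h))
  rw [lintegral_setLIntegral_logKernel_sub hh0] at h1
  have h2 := hball (2 * h) (by positivity) (by linarith [hh.2])
  have h3 : ENNReal.ofReal (h * A) * σ (Metric.closedBall 0 (2 * h)) ≤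
      ENNReal.ofReal (a * h) * ENNReal.ofReal (δ * h) := by
    refine (mul_le_mul' le_rfl h2).trans ?_
    rw [Real.volume_closedBall, ← ENNReal.ofReal_coe_nnreal, ← ENNReal.ofReal_mul η.coe_nonneg,
      ← ENNReal.ofReal_mul (by positivity), ← ENNReal.ofReal_mul (by positivity)]
    apply ENNReal.ofReal_le_ofReal
    change h * A * (a * δ / (4 * (A + 1)) * (2 * (2 * h))) ≤ a * h * (δ * h)
    have h4 : A / (A + 1) ≤ 1 := (div_le_one (by positivity)).2 (by linarith)
    calc _ = a * h * (δ * h) * (A / (A + 1)) := by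
          field_simp
          ring
      _ ≤ _ := mul_le_of_le_one_right (by positivity) h4
  exact (ENNReal.mul_le_mul_iff_right (ENNReal.ofReal_pos.2 (by positivity)).ne'
    ENNReal.ofReal_ne_top).1 (h1.trans h3)

theorem ae_measure_singleton_zero (σ : Measure ℝ) [SFinite σ] : ∀ᵐ y : ℝ, σ {y} = 0 := by
  have h1 := (Measure.countable_meas_level_set_pos (μ := σ) measurable_id).measure_zero volume
  filter_upwards [compl_mem_ae_iff.2 h1] with y hy
  simpa using hy

theorem eventually_abs_entropy_le {C ε : ℝ} (hC : 0 ≤ C) (hε : 0 < ε) :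
    ∀ᶠ h in 𝓝[>] (0 : ℝ), ∀ y, |y| < h →
      C * |(1 - y) * Real.log (1 - y) + (1 + y) * Real.log (1 + y)| ≤ ε * |y| := by
  have h1 : HasDerivAt (fun y : ℝ => 1 - y) (-1) 0 := by
    simpa using (hasDerivAt_id (0 : ℝ)).const_sub 1
  have h2 : HasDerivAt (fun y : ℝ => 1 + y) 1 0 := by
    simpa using (hasDerivAt_id (0 : ℝ)).const_add 1
  have h3 := (h1.mul (h1.log (by norm_num))).add (h2.mul (h2.log (by norm_num)))
  have h4 : HasDerivAt (fun y : ℝ => (1 - y) * Real.log (1 - y) + (1 + y) * Real.log (1 + y))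
      0 0 := h3.congr_deriv (by norm_num)
  have h5 := (hasDerivAt_iff_isLittleO.1 h4).def (show 0 < ε / (C + 1) by positivity)
  obtain ⟨r, hr, h6⟩ := Metric.eventually_nhds_iff.1 h5
  filter_upwards [Ioo_mem_nhdsGT hr] with h hh y hy
  have h7 := h6 (y := y) (by simpa using hy.trans hh.2)
  simp only [sub_zero, add_zero, Real.log_one, mul_zero, smul_zero, Real.norm_eq_abs] at h7
  calc _ ≤ (C + 1) * (ε / (C + 1) * |y|) := by gcongr; linarith
    _ = ε * |y| := by field_simp

theorem IsLebesgueDensityAtZero.tendsto_volume_slope {κ σ₁ σ₂ : Measure ℝ} {c : NNReal}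
    [IsFiniteMeasure κ] (hκ : IsLebesgueDensityAtZero κ c σ₁ σ₂) (hlog : Integrable Real.log κ)
    {ℓ : ℝ} (hℓ : Tendsto (fun h : ℝ => ∫ s, s / (s ^ 2 + h ^ 2) ∂κ) (𝓝[>] 0) (𝓝 ℓ))
    {ε : ℝ} (hε : 0 < ε) :
    Tendsto (fun h : ℝ => (volume {y : ℝ | y ∈ Set.Ioo (-h) h ∧
      ε ≤ |(∫ s, Real.log (s - y) ∂κ - ∫ s, Real.log s ∂κ) / y - -ℓ|}).toReal / (2 * h))
      (𝓝[>] 0) (𝓝 0) := by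
  have := hκ.isFiniteMeasure_add
  rw [Metric.tendsto_nhds]
  intro η hη
  set δ := η / 2
  have hδ : 0 < δ := half_pos hη
  have hℓ' := Metric.tendsto_nhds.1 hℓ (ε / 8) (by positivity)
  filter_upwards [hκ.eventually_integrable_logKernel (show 0 < ε * δ / 8 / 31 by positivity), hℓ',
    eventually_abs_entropy_le (C := c) c.coe_nonneg (show 0 < ε / 8 by positivity),
    eventually_volume_le_setLIntegral_logKernel_sub hκ.tendsto_div
      (show 0 < ε * δ / 4 by positivity) hδ, self_mem_nhdsWithin] with h hL hℓh hp hM hh0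
  have hh : 0 < h := hh0
  set B := {y : ℝ | y ∈ Set.Ioo (-h) h ∧
      ε ≤ |(∫ s, Real.log (s - y) ∂κ - ∫ s, Real.log s ∂κ) / y - -ℓ|}
  set M := {y : ℝ | ENNReal.ofReal (ε * δ / 4 * h) ≤
      ∫⁻ s in Metric.closedBall 0 (2 * h), ENNReal.ofReal (logKernel h (s - y)) ∂(σ₁ + σ₂)}
  have hsub : B ⊆ Metric.closedBall 0 (δ * h) ∪ M ∪ {y | (σ₁ + σ₂) {y} = 0}ᶜ := by
    rintro y ⟨hyh, hy⟩
    by_contra! hcon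
    simp only [Set.mem_union, not_or, Metric.mem_closedBall, dist_zero_right, Real.norm_eq_abs,
      not_le, M, Set.mem_ofPred_eq, Set.mem_compl_iff, not_not] at hcon
    obtain ⟨⟨hyδ, hyM⟩, hyσ⟩ := hcon
    have hyh' : |y| < h := abs_lt.2 hyh
    have hy0 : 0 < |y| := lt_of_le_of_lt (by positivity) hyδ
    have hy0' : y ≠ 0 := abs_pos.1 hy0
    have h1 := hκ.abs_integral_log_sub_le hlog hh hyh' hyσ hL.1 hL.2 hyM
    have h2 := hp y hyh'
    rw [Real.dist_eq] at hℓh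
    set ℓ' := ∫ s, s / (s ^ 2 + h ^ 2) ∂κ
    set D := ∫ s, Real.log (s - y) ∂κ - ∫ s, Real.log s ∂κ
    have h3 : D / y - -ℓ = (D + y * ℓ' - y * (ℓ' - ℓ)) / y := by
      field_simp
      ring
    rw [h3, abs_div, le_div_iff₀ hy0] at hy
    have h4 := abs_sub (D + y * ℓ') (y * (ℓ' - ℓ))
    rw [abs_mul y] at h4
    have h5 : |y| * |ℓ' - ℓ| ≤ |y| * (ε / 8) := by gcongr
    have h6 : ε * (δ * h) < ε * |y| := by gcongr
    have h7 : 0 < ε * |y| := by positivity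
    linarith
  have hvol : volume B ≤ ENNReal.ofReal (3 * δ * h) := by
    calc volume B ≤ volume (Metric.closedBall 0 (δ * h)) + volume M +
          volume {y | (σ₁ + σ₂) {y} = 0}ᶜ :=
        (measure_mono hsub).trans ((measure_union_le _ _).trans
          (add_le_add (measure_union_le _ _) le_rfl))
      _ ≤ ENNReal.ofReal (2 * (δ * h)) + ENNReal.ofReal (δ * h) + 0 := by
        rw [Real.volume_closedBall]
        exact add_le_add (add_le_add le_rfl hM) (ae_measure_singleton_zero (σ₁ + σ₂)).le
      _ = _ := by
        rw [add_zero, ← ENNReal.ofReal_add (by positivity) (by positivity)]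
        ring_nf
  have hB : (volume B).toReal ≤ 3 * δ * h :=
    ENNReal.toReal_le_of_le_ofReal (by positivity) hvol
  rw [Real.dist_eq, sub_zero, abs_of_nonneg (by positivity), div_lt_iff₀ (by positivity)]
  have : η = 2 * δ := by ring
  nlinarith [mul_pos hδ hh]

theorem integrable_cauchyKernel (k : Measure ℝ) [IsFiniteMeasure k] (x : ℝ) {y : ℝ} (hy : 0 < y) :
    Integrable (fun t : ℝ => ((t : ℂ) - (x + y * Complex.I))⁻¹) k := by
  refine Integrable.of_bound (Measurable.aestronglyMeasurable (by fun_prop)) y⁻¹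
    (Eventually.of_forall fun t => ?_)
  rw [norm_inv]
  refine inv_anti₀ hy ?_
  simpa [abs_of_pos hy] using Complex.abs_im_le_norm ((t : ℂ) - (x + y * Complex.I))

theorem integral_map_sub (k : Measure ℝ) (x : ℝ) (f : ℝ → ℝ) :
    ∫ s, f s ∂(k.map (· - x)) = ∫ t, f (t - x) ∂k :=
  (measurableEmbedding_subRight x).integral_map f

theorem re_cauchyTransform (k : Measure ℝ) [IsFiniteMeasure k] (x : ℝ) {y : ℝ} (hy : 0 < y) :
    (∫ t : ℝ, ((t : ℂ) - (x + y * Complex.I))⁻¹ ∂k).re =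
      ∫ s, s / (s ^ 2 + y ^ 2) ∂(k.map (· - x)) := by
  have h := integral_re (integrable_cauchyKernel k x hy)
  simp only [RCLike.re_eq_complex_re] at h
  rw [← h, integral_map_sub]
  simp [Complex.inv_re, Complex.normSq_apply, sq]

theorem im_cauchyTransform (k : Measure ℝ) [IsFiniteMeasure k] (x : ℝ) {y : ℝ} (hy : 0 < y) :
    (∫ t : ℝ, ((t : ℂ) - (x + y * Complex.I))⁻¹ ∂k).im =
      ∫ s, y / (s ^ 2 + y ^ 2) ∂(k.map (· - x)) := by
  have h := integral_im (integrable_cauchyKernel k x hy)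
  simp only [RCLike.im_eq_complex_im] at h
  rw [← h, integral_map_sub]
  simp [Complex.inv_im, Complex.normSq_apply, sq]

/-- The Cauchy transform of a finite measure on `ℝ` has vertical boundary values almost
everywhere. -/
theorem ae_exists_tendsto_cauchyTransform (k : Measure ℝ) [IsFiniteMeasure k] :
    ∀ᵐ x : ℝ, ∃ L : ℂ, Tendsto (fun y : ℝ => ∫ t : ℝ, ((t : ℂ) - (x + y * Complex.I))⁻¹ ∂k)
      (𝓝[>] 0) (𝓝 L) := by
  refine ae_exists_tendsto_of_im_nonneg (g := fun z => ∫ t : ℝ, ((t : ℂ) - z)⁻¹ ∂k)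
    (differentiableOn_cauchyTransform k) (fun z hz => ?_) ?_
  · have h := im_cauchyTransform k z.re hz
    rw [Complex.re_add_im] at h
    rw [h]
    exact integral_nonneg fun s => by positivity
  · filter_upwards [ae_exists_isLebesgueDensityAtZero k] with x ⟨c, σ₁, σ₂, hκ⟩
    refine ⟨c * Real.pi, hκ.tendsto_integral_poissonKernel.congr' ?_⟩
    filter_upwards [self_mem_nhdsWithin] with y hy
    exact (im_cauchyTransform k x hy).symm

theorem integrable_abs_of_isCompact {k : Measure ℝ} [IsFiniteMeasure k] {B : Set ℝ}
    (hB : IsCompact B) (hk : k Bᶜ = 0) : Integrable (fun t : ℝ => |t|) k := by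
  obtain ⟨C, hC⟩ := hB.isBounded.exists_norm_le
  refine Integrable.of_bound continuous_abs.aestronglyMeasurable C ?_
  filter_upwards [compl_mem_ae_iff.2 hk] with t ht
  simpa using hC t (by simpa using ht)

/-- Theorem 4.2: let `k` be a compactly supported probability Borel measure on `ℝ`,
`γ` its logarithmic potential and `g(x) = lim_{y→0+} ∫ dk(t)/(t - x - iy)` (which exists
for a.e. `x`). Then for Lebesgue-a.e. `x`, `γ` is approximately differentiable at `x`
with `(D_ap γ)(x) = -Re g(x)`. -/
theorem approxDeriv_logPotential_eq_neg_re_g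
    (k : Measure ℝ) [IsProbabilityMeasure k]
    (hsupp : ∃ B : Set ℝ, IsCompact B ∧ k Bᶜ = 0) :
    ∀ᵐ x : ℝ, ∃ L : ℂ,
      Tendsto (fun y : ℝ => ∫ t : ℝ, ((t : ℂ) - (x : ℂ) - y * Complex.I)⁻¹ ∂k)
        (𝓝[>] (0 : ℝ)) (𝓝 L) ∧
      HasApproxDerivAt (logPotential k) (-L.re) x := by
  obtain ⟨B, hB, hkB⟩ := hsupp
  have habs := integrable_abs_of_isCompact hB hkB
  filter_upwards [ae_exists_tendsto_cauchyTransform k, ae_exists_isLebesgueDensityAtZero k]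
    with x ⟨L, hL⟩ ⟨c, σ₁, σ₂, hκ⟩
  refine ⟨L, by simpa only [sub_sub] using hL, fun ε hε => ?_⟩
  have hint : Integrable (fun s : ℝ => |s|) (k.map (· - x)) := by
    refine (measurableEmbedding_subRight x).integrable_map_iff.2 ?_
    refine (habs.add (integrable_const |x|)).mono' (by fun_prop) (Eventually.of_forall fun t => ?_)
    simpa using abs_sub t x
  have hℓ : Tendsto (fun h : ℝ => ∫ s, s / (s ^ 2 + h ^ 2) ∂(k.map (· - x))) (𝓝[>] 0)
      (𝓝 L.re) := by
    refine ((Complex.continuous_re.tendsto L).comp hL).congr' ?_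
    filter_upwards [self_mem_nhdsWithin] with y hy
    exact re_cauchyTransform k x hy
  have h1 : ∀ y, logPotential k (x + y) = ∫ s, Real.log (s - y) ∂(k.map (· - x)) := fun y => by
    rw [integral_map_sub k x fun s => Real.log (s - y)]
    simp only [logPotential, Real.log_abs, sub_sub]
  have h2 : logPotential k x = ∫ s, Real.log s ∂(k.map (· - x)) := by
    simpa using h1 0
  simp only [h1, h2]
  exact hκ.tendsto_volume_slope (hκ.integrable_log hint) hℓ hε
end

section
/- Let k be a probability Borel measure on ℝ with compact support, γ(x) = ∫_ℝ ln|t−x| dk(t) its logarithmic potential, and g(x) = lim_{y→0+} ∫_ℝ dk(t)/(t−x−iy) (which exists for Lebesgue-a.e. x). Let K = {c ∈ ℝ : |γ^{−1}({c})| > 0} (the set of values whose level sets have positive Lebesgue measure) and C = γ^{−1}(K). Then Re g(x) = 0 for Lebesgue-almost every x ∈ C; i.e., the Herglotz function g(z) = ∫ dk(t)/(t−z) is reflectionless on C. -/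
open MeasureTheory Filter Topology

/-- The Poisson integral `∫ y / ((t - x)² + y²) dk(t)` of a measure `k`. -/
noncomputable def poissonIntegral (k : Measure ℝ) (x y : ℝ) : ℝ :=
  ∫ t, y / ((t - x) ^ 2 + y ^ 2) ∂k

/-- The conjugate Poisson integral `∫ (t - x) / ((t - x)² + y²) dk(t)` of a measure `k`. -/
noncomputable def conjPoissonIntegral (k : Measure ℝ) (x y : ℝ) : ℝ :=
  ∫ t, (t - x) / ((t - x) ^ 2 + y ^ 2) ∂k

/-- The logarithmic potential `∫ ln √((t - x)² + y²) dk(t)` at the point `x + iy`. -/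
noncomputable def planarLogPotential (k : Measure ℝ) (x y : ℝ) : ℝ :=
  ∫ t, Real.log ((t - x) ^ 2 + y ^ 2) / 2 ∂k

theorem sq_add_sq_pos_of_right {y : ℝ} (hy : 0 < y) (u : ℝ) : 0 < u ^ 2 + y ^ 2 := by positivity

theorem integrable_poissonKernel (k : Measure ℝ) [IsFiniteMeasure k] (x : ℝ) {y : ℝ}
    (hy : 0 < y) : Integrable (fun t => y / ((t - x) ^ 2 + y ^ 2)) k := by
  refine Integrable.of_bound (C := 1 / y)
    (Measurable.aestronglyMeasurable (by fun_prop)) (.of_forall fun t => ?_)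
  have h := sq_add_sq_pos_of_right hy (t - x)
  rw [Real.norm_of_nonneg (by positivity), div_le_div_iff₀ h hy]
  nlinarith [sq_nonneg (t - x)]

theorem integrable_conjPoissonKernel_s13 (k : Measure ℝ) [IsFiniteMeasure k] (x : ℝ) {y : ℝ}
    (hy : 0 < y) : Integrable (fun t => (t - x) / ((t - x) ^ 2 + y ^ 2)) k := by
  refine Integrable.of_bound (C := 1 / y)
    (Measurable.aestronglyMeasurable (by fun_prop)) (.of_forall fun t => ?_)
  have h := sq_add_sq_pos_of_right hy (t - x)
  rw [norm_div, Real.norm_of_nonneg h.le, div_le_div_iff₀ h hy, Real.norm_eq_abs]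
  nlinarith [sq_abs (t - x), sq_nonneg (|t - x| - y)]

theorem integral_inv_sub_eq (k : Measure ℝ) [IsFiniteMeasure k] (x : ℝ) {y : ℝ} (hy : 0 < y) :
    ∫ t : ℝ, ((t : ℂ) - (x : ℂ) - y * Complex.I)⁻¹ ∂k =
      conjPoissonIntegral k x y + poissonIntegral k x y * Complex.I := by
  have h (t : ℝ) : ((t : ℂ) - (x : ℂ) - y * Complex.I)⁻¹ =
      (((t - x) / ((t - x) ^ 2 + y ^ 2) : ℝ) : ℂ) +
        ((y / ((t - x) ^ 2 + y ^ 2) : ℝ) : ℂ) * Complex.I := by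
    apply Complex.ext <;>
      simp [Complex.inv_re, Complex.inv_im, Complex.normSq_apply, -Complex.ofReal_div,
        -Complex.ofReal_add, -Complex.ofReal_pow] <;> ring_nf
  simp_rw [h]
  rw [integral_add (integrable_conjPoissonKernel_s13 k x hy).ofReal
    ((integrable_poissonKernel k x hy).ofReal.mul_const _), integral_mul_const,
    integral_complex_ofReal, integral_complex_ofReal]
  rfl

theorem ae_exists_tendsto_measureReal_closedBall_div (k : Measure ℝ) [IsFiniteMeasure k] :
    ∀ᵐ x : ℝ, ∃ f : ℝ,
      Tendsto (fun r => k.real (Metric.closedBall x r) / r) (𝓝[>] 0) (𝓝 f) := by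
  filter_upwards [Besicovitch.ae_tendsto_rnDeriv k volume, k.rnDeriv_lt_top volume] with x hx hlt
  refine ⟨2 * (k.rnDeriv volume x).toReal,
    (((ENNReal.tendsto_toReal hlt.ne).comp hx).const_mul 2).congr' ?_⟩
  filter_upwards [self_mem_nhdsWithin] with r hr
  have hr : 0 < r := hr
  simp only [Function.comp_apply, Real.volume_closedBall, ENNReal.toReal_div, measureReal_def]
  rw [ENNReal.toReal_ofReal (by positivity)]
  field_simp

theorem exists_measureReal_closedBall_le {k : Measure ℝ} [IsFiniteMeasure k] {x f : ℝ}
    (hf : Tendsto (fun r => k.real (Metric.closedBall x r) / r) (𝓝[>] 0) (𝓝 f)) :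
    ∃ M, 0 ≤ M ∧ ∀ r, 0 < r → k.real (Metric.closedBall x r) ≤ M * r := by
  have h1 := hf.eventually_le_const (lt_add_one f)
  obtain ⟨δ, hδ, h⟩ := mem_nhdsGT_iff_exists_Ioo_subset.1 h1
  have hδ : 0 < δ := hδ
  refine ⟨max (f + 1) (k.real Set.univ / δ), le_max_of_le_right (by positivity), fun r hr => ?_⟩
  rcases lt_or_ge r δ with hrd | hrd
  · calc k.real (Metric.closedBall x r) ≤ (f + 1) * r := (div_le_iff₀ hr).1 (h ⟨hr, hrd⟩)
      _ ≤ _ := by gcongr; exact le_max_left _ _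
  · calc k.real (Metric.closedBall x r) ≤ k.real Set.univ := measureReal_mono (Set.subset_univ _)
      _ = k.real Set.univ / δ * δ := by field_simp
      _ ≤ k.real Set.univ / δ * r := by gcongr
      _ ≤ _ := by gcongr; exact le_max_right _ _

theorem measure_singleton_eq_zero_of_closedBall_le {k : Measure ℝ} [IsFiniteMeasure k] {x M : ℝ}
    (hM : ∀ r, 0 < r → k.real (Metric.closedBall x r) ≤ M * r) : k {x} = 0 := by
  have h : k.real {x} ≤ 0 := by
    have h0 : Tendsto (fun r : ℝ => M * r) (𝓝[>] 0) (𝓝 0) := by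
      have : Tendsto (fun r : ℝ => M * r) (𝓝 0) (𝓝 (M * 0)) := tendsto_id.const_mul M
      rw [mul_zero] at this
      exact this.mono_left nhdsWithin_le_nhds
    refine ge_of_tendsto h0 ?_
    filter_upwards [self_mem_nhdsWithin] with r hr
    have hr : 0 < r := hr
    refine (measureReal_mono ?_).trans (hM r hr)
    simpa using hr.le
  exact (measureReal_eq_zero_iff).1 (h.antisymm measureReal_nonneg)

theorem poissonIntegral_eq_integral_closedBall (k : Measure ℝ) [IsFiniteMeasure k] (x : ℝ)
    {y : ℝ} (hy : 0 < y) : poissonIntegral k x y =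
      ∫ s in Set.Ioc (0 : ℝ) 1, k.real (Metric.closedBall x (y * √(1 / s - 1))) / y := by
  have h1 : poissonIntegral k x y = (∫ t, y ^ 2 / ((t - x) ^ 2 + y ^ 2) ∂k) / y := by
    rw [← integral_div, poissonIntegral]
    congr with t
    field_simp
  have hint : Integrable (fun t => y ^ 2 / ((t - x) ^ 2 + y ^ 2)) k := by
    refine ((integrable_poissonKernel k x hy).const_mul y).congr (.of_forall fun t => ?_)
    ring
  rw [h1, hint.integral_eq_integral_Ioc_meas_le (M := 1) (.of_forall fun t => by positivity)
    (.of_forall fun t => div_le_one_of_le₀ (by nlinarith [sq_nonneg (t - x)]) (by positivity)),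
    ← integral_div]
  refine setIntegral_congr_fun measurableSet_Ioc fun s hs => ?_
  have hs0 : 0 < s := hs.1
  have hs1 : 0 ≤ 1 / s - 1 := by
    rw [sub_nonneg, le_div_iff₀ hs0]; linarith [hs.2]
  have : {t : ℝ | s ≤ y ^ 2 / ((t - x) ^ 2 + y ^ 2)} =
      Metric.closedBall x (y * √(1 / s - 1)) := by
    ext t
    rw [Set.mem_ofPred_eq, Metric.mem_closedBall, Real.dist_eq,
      le_div_iff₀ (sq_add_sq_pos_of_right hy _), ← abs_of_nonneg (a := y * √(1 / s - 1))
      (by positivity), ← sq_le_sq, mul_pow, Real.sq_sqrt hs1, mul_sub, mul_one_div,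
      le_sub_iff_add_le, le_div_iff₀ hs0]
    ring_nf
  simp only [this]

theorem integrableOn_sqrt_inv_sub_one :
    IntegrableOn (fun s : ℝ => √(1 / s - 1)) (Set.Ioc 0 1) := by
  have h : IntegrableOn (fun s : ℝ => s ^ (-(1 / 2) : ℝ)) (Set.Ioc 0 1) := by
    rw [← intervalIntegrable_iff_integrableOn_Ioc_of_le zero_le_one]
    exact intervalIntegral.intervalIntegrable_rpow' (by norm_num)
  refine h.mono' (by fun_prop) ?_
  filter_upwards [ae_restrict_mem measurableSet_Ioc] with s hs
  rw [Real.norm_of_nonneg (Real.sqrt_nonneg _), Real.rpow_neg hs.1.le, ← Real.sqrt_eq_rpow,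
    ← Real.sqrt_inv]
  gcongr
  rw [one_div]; linarith

theorem exists_tendsto_poissonIntegral {k : Measure ℝ} [IsFiniteMeasure k] {x f : ℝ}
    (hf : Tendsto (fun r => k.real (Metric.closedBall x r) / r) (𝓝[>] 0) (𝓝 f)) :
    ∃ p, Tendsto (poissonIntegral k x) (𝓝[>] 0) (𝓝 p) := by
  obtain ⟨M, hM0, hM⟩ := exists_measureReal_closedBall_le hf
  refine ⟨∫ s in Set.Ioc (0 : ℝ) 1, f * √(1 / s - 1), Tendsto.congr'
    (f₁ := fun y => ∫ s in Set.Ioc (0 : ℝ) 1,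
      k.real (Metric.closedBall x (y * √(1 / s - 1))) / y) ?_ ?_⟩
  · filter_upwards [self_mem_nhdsWithin] with y hy
    exact (poissonIntegral_eq_integral_closedBall k x hy).symm
  have hpos : ∀ᵐ s ∂volume.restrict (Set.Ioc (0 : ℝ) 1), 0 < √(1 / s - 1) := by
    have : ∀ᵐ s : ℝ, s ≠ 1 := by simp [ae_iff]
    filter_upwards [ae_restrict_mem measurableSet_Ioc, ae_restrict_of_ae this] with s hs hs1
    rw [Real.sqrt_pos, sub_pos, lt_div_iff₀ hs.1, one_mul]
    exact lt_of_le_of_ne hs.2 hs1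
  refine tendsto_integral_filter_of_dominated_convergence (fun s => M * √(1 / s - 1))
    ?_ ?_ (integrableOn_sqrt_inv_sub_one.const_mul M) ?_
  · refine .of_forall fun y => ?_
    have hmono : Monotone fun r => k.real (Metric.closedBall x r) := fun a b hab =>
      measureReal_mono (Metric.closedBall_subset_closedBall hab)
    have := hmono.measurable
    exact ((this.comp (by fun_prop : Measurable fun s : ℝ => y * √(1 / s - 1))).div_const
      y).aestronglyMeasurable
  · filter_upwards [self_mem_nhdsWithin] with y hy
    have hy : 0 < y := hy
    filter_upwards [hpos] with s hs
    rw [Real.norm_of_nonneg (by positivity), div_le_iff₀ hy]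
    exact (hM _ (by positivity)).trans_eq (by ring)
  · filter_upwards [hpos] with s hs
    have hlim : Tendsto (fun y : ℝ => y * √(1 / s - 1)) (𝓝[>] 0) (𝓝[>] 0) := by
      refine tendsto_nhdsWithin_iff.2 ⟨?_, ?_⟩
      · have : Tendsto (fun y : ℝ => y * √(1 / s - 1)) (𝓝 0) (𝓝 (0 * √(1 / s - 1))) :=
          tendsto_id.mul_const _
        rw [zero_mul] at this
        exact this.mono_left nhdsWithin_le_nhds
      · filter_upwards [self_mem_nhdsWithin] with y hy
        exact mul_pos hy hs
    refine ((hf.comp hlim).mul_const (√(1 / s - 1))).congr' ?_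
    filter_upwards [self_mem_nhdsWithin] with y hy
    have hy : 0 < y := hy
    simp only [Function.comp_apply]
    field_simp

theorem integrable_of_continuous_of_compl_null {k : Measure ℝ} [IsFiniteMeasure k] {B : Set ℝ}
    (hB : IsCompact B) (hkB : k Bᶜ = 0) {f : ℝ → ℝ} (hf : Continuous f) : Integrable f k := by
  have h : k.restrict B = k := Measure.restrict_eq_self_of_ae_mem (by
    rw [ae_iff]; exact hkB)
  have := hf.continuousOn.integrableOn_compact (μ := k) hB
  rwa [IntegrableOn, h] at this

theorem continuous_log_sq_add_sq (x : ℝ) {y : ℝ} (hy : 0 < y) :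
    Continuous fun t => Real.log ((t - x) ^ 2 + y ^ 2) / 2 :=
  (Continuous.log (by fun_prop) fun t => (sq_add_sq_pos_of_right hy _).ne').div_const 2

theorem integrable_log_abs_sub {k : Measure ℝ} [IsFiniteMeasure k] {B : Set ℝ}
    (hB : IsCompact B) (hkB : k Bᶜ = 0) {x M : ℝ}
    (hM : ∀ r, 0 < r → k.real (Metric.closedBall x r) ≤ M * r) :
    Integrable (fun t => Real.log |t - x|) k := by
  have hneg : Integrable (fun t => max (-Real.log |t - x|) 0) k := by
    have hm : Measurable fun t : ℝ => max (-Real.log |t - x|) 0 := by fun_prop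
    have hnn : 0 ≤ᵐ[k] fun t => max (-Real.log |t - x|) 0 :=
      .of_forall fun t => le_max_right _ _
    refine (lintegral_ofReal_ne_top_iff_integrable hm.aestronglyMeasurable hnn).1 ?_
    rw [lintegral_eq_lintegral_meas_le k hnn hm.aemeasurable]
    refine ne_top_of_le_ne_top ((integrableOn_exp_neg_Ioi 0).const_mul M).lintegral_lt_top.ne
      (setLIntegral_mono' measurableSet_Ioi fun s hs => ?_)
    have hs : 0 < s := hs
    have hsub : {t : ℝ | s ≤ max (-Real.log |t - x|) 0} ⊆
        Metric.closedBall x (Real.exp (-s)) := by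
      intro t ht
      rw [Set.mem_ofPred_eq, le_max_iff] at ht
      have ht : Real.log |t - x| ≤ -s := by
        rcases ht with h | h <;> linarith
      rw [Metric.mem_closedBall, Real.dist_eq]
      rcases eq_or_ne t x with rfl | hne
      · simp [Real.exp_nonneg]
      · rwa [← Real.log_le_iff_le_exp (abs_pos.2 (sub_ne_zero.2 hne))]
    refine (measure_mono hsub).trans ?_
    rw [← ofReal_measureReal]
    exact ENNReal.ofReal_le_ofReal (hM _ (Real.exp_pos _))
  have hpos : Integrable (fun t => |t - x|) k :=
    integrable_of_continuous_of_compl_null hB hkB (by fun_prop)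
  refine (hneg.add hpos).mono' (Measurable.aestronglyMeasurable (by fun_prop))
    (.of_forall fun t => ?_)
  have h1 := Real.log_le_self (abs_nonneg (t - x))
  have h2 := le_max_left (-Real.log |t - x|) 0
  have h3 := le_max_right (-Real.log |t - x|) 0
  rw [Real.norm_eq_abs, Pi.add_apply, abs_le]
  constructor <;> linarith [abs_nonneg (t - x)]

theorem planarLogPotential_zero (k : Measure ℝ) (x : ℝ) :
    planarLogPotential k x 0 = logPotential k x := by
  unfold planarLogPotential logPotential
  congr with t
  rw [Real.log_abs, zero_pow two_ne_zero, add_zero, Real.log_pow]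
  push_cast
  ring

theorem tendsto_planarLogPotential {k : Measure ℝ} [IsFiniteMeasure k] {B : Set ℝ}
    (hB : IsCompact B) (hkB : k Bᶜ = 0) {x : ℝ} (hx : k {x} = 0)
    (hlog : Integrable (fun t => Real.log |t - x|) k) :
    Tendsto (planarLogPotential k x) (𝓝[>] 0) (𝓝 (planarLogPotential k x 0)) := by
  have hne : ∀ᵐ t ∂k, t ≠ x := by rw [ae_iff]; simpa using hx
  refine tendsto_integral_filter_of_dominated_convergence
    (fun t => abs (Real.log |t - x|) + |Real.log ((t - x) ^ 2 + 1 ^ 2) / 2|)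
    (.of_forall fun y => Measurable.aestronglyMeasurable (by fun_prop)) ?_
    (hlog.abs.add
      (integrable_of_continuous_of_compl_null hB hkB (continuous_log_sq_add_sq x one_pos)).abs) ?_
  · filter_upwards [Ioo_mem_nhdsGT one_pos] with y hy
    filter_upwards [hne] with t ht
    have ht : 0 < (t - x) ^ 2 := by have := sub_ne_zero.2 ht; positivity
    have h1 : Real.log |t - x| = Real.log ((t - x) ^ 2) / 2 := by
      rw [Real.log_abs, Real.log_pow]; push_cast; ring
    have h2 : Real.log ((t - x) ^ 2) ≤ Real.log ((t - x) ^ 2 + y ^ 2) :=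
      Real.log_le_log ht (by nlinarith [sq_nonneg y])
    have h3 : Real.log ((t - x) ^ 2 + y ^ 2) ≤ Real.log ((t - x) ^ 2 + 1 ^ 2) :=
      Real.log_le_log (by positivity) (by nlinarith [hy.1, hy.2])
    rw [h1, Real.norm_eq_abs]
    exact (abs_le_max_abs_abs (div_le_div_of_nonneg_right h2 two_pos.le)
      (div_le_div_of_nonneg_right h3 two_pos.le)).trans
      (max_le_add_of_nonneg (abs_nonneg _) (abs_nonneg _))
  · filter_upwards [hne] with t ht
    have ht : (t - x) ^ 2 + (0 : ℝ) ^ 2 ≠ 0 := by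
      have := sub_ne_zero.2 ht; positivity
    have hc : ContinuousAt (fun y : ℝ => Real.log ((t - x) ^ 2 + y ^ 2) / 2) 0 :=
      (ContinuousAt.log (f := fun y : ℝ => (t - x) ^ 2 + y ^ 2) (by fun_prop) ht).div_const 2
    exact hc.tendsto.mono_left nhdsWithin_le_nhds

theorem hasDerivAt_planarLogPotential {k : Measure ℝ} [IsFiniteMeasure k] {B : Set ℝ}
    (hB : IsCompact B) (hkB : k Bᶜ = 0) (x : ℝ) {y : ℝ} (hy : 0 < y) :
    HasDerivAt (planarLogPotential k x) (poissonIntegral k x y) y := by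
  refine (hasDerivAt_integral_of_dominated_loc_of_deriv_le (s := Set.Ioi (y / 2))
    (F' := fun s t => s / ((t - x) ^ 2 + s ^ 2)) (bound := fun _ => 2 / y)
    (Ioi_mem_nhds (by linarith))
    (.of_forall fun y => Measurable.aestronglyMeasurable (by fun_prop))
    (integrable_of_continuous_of_compl_null hB hkB (continuous_log_sq_add_sq x hy))
    (integrable_poissonKernel k x hy).aestronglyMeasurable
    (.of_forall fun t s hs => ?_) (integrable_const _) (.of_forall fun t s hs => ?_)).2
  · have hs : y / 2 < s := hs
    have hs0 : 0 < s := by linarith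
    rw [Real.norm_of_nonneg (by positivity), div_le_div_iff₀ (by positivity) hy]
    nlinarith [sq_nonneg (t - x)]
  · have hs : y / 2 < s := hs
    have hs0 : 0 < s := by linarith
    have h := (sq_add_sq_pos_of_right hs0 (t - x)).ne'
    have := ((((hasDerivAt_id s).pow 2).const_add ((t - x) ^ 2)).log h).div_const 2
    refine this.congr_deriv ?_
    simp
    field_simp

theorem tendsto_planarLogPotential_slope {k : Measure ℝ} [IsFiniteMeasure k] {B : Set ℝ}
    (hB : IsCompact B) (hkB : k Bᶜ = 0) {x p : ℝ} (hx : k {x} = 0)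
    (hlog : Integrable (fun t => Real.log |t - x|) k)
    (hp : Tendsto (poissonIntegral k x) (𝓝[>] 0) (𝓝 p)) :
    Tendsto (fun y => (planarLogPotential k x y - logPotential k x) / y) (𝓝[>] 0) (𝓝 p) := by
  have h : HasDerivWithinAt (planarLogPotential k x) p (Set.Ici 0) 0 := by
    refine hasDerivWithinAt_Ici_of_tendsto_deriv (s := Set.Ioi 0)
      (fun y hy => (hasDerivAt_planarLogPotential hB hkB x hy).differentiableAt
        |>.differentiableWithinAt)
      (tendsto_planarLogPotential hB hkB hx hlog) self_mem_nhdsWithin (hp.congr' ?_)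
    filter_upwards [self_mem_nhdsWithin] with y hy
    exact (hasDerivAt_planarLogPotential hB hkB x hy).deriv.symm
  have h2 := (hasDerivWithinAt_iff_tendsto_slope' Set.self_notMem_Ioi).1 h.Ioi_of_Ici
  refine h2.congr fun y => ?_
  rw [slope_def_field, planarLogPotential_zero, sub_zero]

theorem abs_log_sub_log_add_le {u h y : ℝ} (hy : 0 < y) (hh : |h| ≤ y / 4) :
    |Real.log ((u - h) ^ 2 + y ^ 2) / 2 - Real.log (u ^ 2 + y ^ 2) / 2 +
      h * (u / (u ^ 2 + y ^ 2))| ≤ 12 * h ^ 2 / y * (y / (u ^ 2 + y ^ 2)) := by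
  have hN := sq_add_sq_pos_of_right hy u
  obtain ⟨hh1, hh2⟩ := abs_le.1 hh
  have hhsq : h ^ 2 ≤ y ^ 2 / 16 := by nlinarith
  set N := u ^ 2 + y ^ 2 with hNdef
  set w := (2 * u * h - h ^ 2) / N with hw
  have huh : |2 * u * h| ≤ N / 4 := by
    rw [abs_le, hNdef]
    constructor <;> nlinarith [sq_nonneg (u + 4 * h), sq_nonneg (u - 4 * h)]
  have hw1 : |w| ≤ 1 / 2 := by
    rw [hw, abs_div, abs_of_pos hN, div_le_iff₀ hN, abs_le]
    obtain ⟨h1, h2⟩ := abs_le.1 huh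
    constructor <;> nlinarith [sq_nonneg u, sq_nonneg h]
  have hw2 : w ^ 2 ≤ 10 * h ^ 2 / N := by
    rw [hw, div_pow, div_le_div_iff₀ (by positivity) hN]
    have : (2 * u * h - h ^ 2) ^ 2 ≤ 10 * h ^ 2 * N := by
      have : (2 * u - h) ^ 2 ≤ 10 * N := by
        nlinarith [sq_nonneg (2 * u + h), sq_nonneg u]
      nlinarith [mul_le_mul_of_nonneg_left this (sq_nonneg h)]
    nlinarith
  have hfac : (u - h) ^ 2 + y ^ 2 = N * (1 - w) := by
    rw [hw, hNdef]; field_simp; ring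
  have h1w : 0 < 1 - w := by linarith [le_abs_self w]
  rw [hfac, Real.log_mul hN.ne' h1w.ne']
  have key := Real.abs_log_sub_add_sum_range_le (x := w) (by linarith) 1
  simp only [Finset.sum_range_one, zero_add, pow_one, Nat.cast_zero, div_one] at key
  have key2 : |w| ^ (1 + 1) / (1 - |w|) ≤ 2 * (10 * h ^ 2 / N) := by
    rw [div_le_iff₀ (by linarith), sq_abs]
    nlinarith [sq_nonneg w]
  obtain ⟨k1, k2⟩ := abs_le.1 (key.trans key2)
  have e1 : (Real.log N + Real.log (1 - w)) / 2 - Real.log N / 2 + h * (u / N) =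
      (w + Real.log (1 - w)) / 2 + h ^ 2 / N / 2 := by
    rw [hw]; field_simp; ring
  have e2 : 12 * h ^ 2 / y * (y / N) = 12 * (h ^ 2 / N) := by field_simp
  have e3 : 10 * h ^ 2 / N = 10 * (h ^ 2 / N) := by ring
  have e4 : 0 ≤ h ^ 2 / N := by positivity
  rw [e1, e2, abs_le]
  rw [e3] at k1 k2
  constructor <;> linarith

theorem abs_planarLogPotential_sub_add_le {k : Measure ℝ} [IsFiniteMeasure k] {B : Set ℝ}
    (hB : IsCompact B) (hkB : k Bᶜ = 0) (x : ℝ) {h y : ℝ} (hy : 0 < y) (hh : |h| ≤ y / 4) :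
    |planarLogPotential k (x + h) y - planarLogPotential k x y + h * conjPoissonIntegral k x y| ≤
      12 * h ^ 2 / y * poissonIntegral k x y := by
  have i1 (z : ℝ) :=
    integrable_of_continuous_of_compl_null hB hkB (continuous_log_sq_add_sq z hy)
  have i3 : Integrable (fun t => Real.log ((t - (x + h)) ^ 2 + y ^ 2) / 2 -
      Real.log ((t - x) ^ 2 + y ^ 2) / 2) k := (i1 _).sub (i1 _)
  have i2 := (integrable_conjPoissonKernel_s13 k x hy).const_mul h
  unfold planarLogPotential conjPoissonIntegral poissonIntegral
  rw [← integral_const_mul, ← integral_const_mul, ← integral_sub (i1 _) (i1 _),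
    ← integral_add i3 i2]
  rw [← Real.norm_eq_abs]
  refine norm_integral_le_of_norm_le ((integrable_poissonKernel k x hy).const_mul _)
    (.of_forall fun t => ?_)
  have := abs_log_sub_log_add_le (u := t - x) hy hh
  rwa [sub_sub] at this

theorem eventually_exists_mem_of_tendsto_density {A : Set ℝ} {x : ℝ}
    (hA : Tendsto (fun r => volume (A ∩ Metric.closedBall x r) / volume (Metric.closedBall x r))
      (𝓝[>] 0) (𝓝 1)) :
    ∀ᶠ r in 𝓝[>] (0 : ℝ), ∃ h, r / 2 ≤ |h| ∧ |h| ≤ r ∧ x + h ∈ A := by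
  have h2 : (2⁻¹ : ENNReal) < 1 := ENNReal.inv_lt_one.2 ENNReal.one_lt_two
  filter_upwards [hA.eventually_const_lt h2, self_mem_nhdsWithin] with r hr hr0
  have hr0 : 0 < r := hr0
  by_contra! hcon
  refine hr.not_ge ?_
  have hsub : A ∩ Metric.closedBall x r ⊆ Metric.closedBall x (r / 2) := by
    rintro z ⟨hzA, hz⟩
    rw [Metric.mem_closedBall, Real.dist_eq] at hz ⊢
    by_contra! hlt
    exact hcon (z - x) hlt.le hz (by simpa using hzA)
  refine (ENNReal.div_le_div_right (measure_mono hsub) _).trans ?_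
  rw [Real.volume_closedBall, Real.volume_closedBall,
    ← ENNReal.ofReal_div_of_pos (by positivity)]
  have : 2 * (r / 2) / (2 * r) = (2 : ℝ)⁻¹ := by field_simp
  rw [this, ENNReal.ofReal_inv_of_pos two_pos]
  simp

theorem eventually_abs_conjPoissonIntegral_le {k : Measure ℝ} [IsFiniteMeasure k] {B : Set ℝ}
    (hB : IsCompact B) (hkB : k Bᶜ = 0) {A : Set ℝ} {x c q δ θ : ℝ} (hδ : 0 < δ) (hθ : 0 < θ)
    (hθ4 : θ ≤ 1 / 4)
    (hA : ∀ z ∈ A, ∀ y, 0 < y → y < δ → |(planarLogPotential k z y - c) / y - q| ≤ θ ^ 2)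
    (hxA : x ∈ A)
    (hx : Tendsto (fun r => volume (A ∩ Metric.closedBall x r) / volume (Metric.closedBall x r))
      (𝓝[>] 0) (𝓝 1)) :
    ∀ᶠ y in 𝓝[>] (0 : ℝ),
      |conjPoissonIntegral k x y| ≤ θ * (4 + 12 * poissonIntegral k x y) := by
  have hlim : Tendsto (fun y : ℝ => θ * y) (𝓝[>] 0) (𝓝[>] 0) := by
    refine tendsto_nhdsWithin_iff.2 ⟨?_, ?_⟩
    · have : Tendsto (fun y : ℝ => θ * y) (𝓝 0) (𝓝 (θ * 0)) := tendsto_id.const_mul _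
      rw [mul_zero] at this
      exact this.mono_left nhdsWithin_le_nhds
    · filter_upwards [self_mem_nhdsWithin] with y hy
      exact mul_pos hθ hy
  filter_upwards [hlim.eventually (eventually_exists_mem_of_tendsto_density hx),
    Ioo_mem_nhdsGT hδ] with y ⟨h, hh1, hh2, hhA⟩ hy
  have hy0 : 0 < y := hy.1
  have hh0 : 0 < |h| := lt_of_lt_of_le (by positivity) hh1
  have key := abs_planarLogPotential_sub_add_le hB hkB x hy0
    (hh2.trans (by nlinarith) : |h| ≤ y / 4)
  have hP : 0 ≤ poissonIntegral k x y := integral_nonneg fun t => by positivity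
  have hdiff : |planarLogPotential k (x + h) y - planarLogPotential k x y| ≤ 2 * θ ^ 2 * y := by
    obtain ⟨a1, a2⟩ := abs_le.1 (hA _ hhA y hy0 hy.2)
    obtain ⟨b1, b2⟩ := abs_le.1 (hA _ hxA y hy0 hy.2)
    have e : planarLogPotential k (x + h) y - planarLogPotential k x y =
        ((planarLogPotential k (x + h) y - c) / y - q -
          ((planarLogPotential k x y - c) / y - q)) * y := by
      field_simp
      ring
    rw [e, abs_mul, abs_of_pos hy0]
    gcongr
    rw [abs_le]
    constructor <;> linarith
  have hsq : 12 * h ^ 2 / y ≤ 12 * θ * |h| := by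
    rw [div_le_iff₀ hy0, ← sq_abs]
    nlinarith
  have hmul : |h| * |conjPoissonIntegral k x y| ≤
      |h| * (θ * (4 + 12 * poissonIntegral k x y)) := by
    rw [← abs_mul]
    have h4 : 2 * θ ^ 2 * y ≤ 4 * θ * |h| := by nlinarith
    calc |h * conjPoissonIntegral k x y|
        = |(planarLogPotential k (x + h) y - planarLogPotential k x y +
            h * conjPoissonIntegral k x y) -
            (planarLogPotential k (x + h) y - planarLogPotential k x y)| := by congr 1; ring
      _ ≤ 12 * h ^ 2 / y * poissonIntegral k x y + 2 * θ ^ 2 * y :=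
          (abs_sub _ _).trans (add_le_add key hdiff)
      _ ≤ 12 * θ * |h| * poissonIntegral k x y + 4 * θ * |h| := by
          gcongr
      _ = _ := by ring
  exact le_of_mul_le_mul_left hmul hh0

theorem measurable_logPotential (k : Measure ℝ) [SFinite k] : Measurable (logPotential k) := by
  have h : Measurable fun p : ℝ × ℝ => Real.log |p.2 - p.1| := by fun_prop
  exact h.stronglyMeasurable.integral_prod_right.measurable

/-- Corollary 4.1: let `k` be a compactly supported probability Borel measure on `ℝ`
with logarithmic potential `γ`, let `K` be the set of values `c` whose level set
`γ⁻¹({c})` has positive Lebesgue measure, and let `C = γ⁻¹(K)` (equivalently,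
`C = {x : |{y : γ(y) = γ(x)}| > 0}`). Then the Herglotz function
`g(z) = ∫ dk(t)/(t - z)` is reflectionless on `C`: for Lebesgue-a.e. `x ∈ C`, the
boundary value `g(x) = lim_{y→0+} ∫ dk(t)/(t - x - iy)` exists and `Re g(x) = 0`. -/
theorem re_g_vanishes_on_thick_level_sets
    (k : Measure ℝ) [IsProbabilityMeasure k]
    (hsupp : ∃ B : Set ℝ, IsCompact B ∧ k Bᶜ = 0) :
    ∀ᵐ x : ℝ ∂(volume.restrict
      {x : ℝ | 0 < volume {y : ℝ | logPotential k y = logPotential k x}}),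
      ∃ L : ℂ,
        Tendsto (fun y : ℝ => ∫ t : ℝ, ((t : ℂ) - (x : ℂ) - y * Complex.I)⁻¹ ∂k)
          (𝓝[>] (0 : ℝ)) (𝓝 L) ∧
        L.re = 0 := by
  obtain ⟨B, hB, hkB⟩ := hsupp
  let K : Set ℝ := {c | 0 < volume {y : ℝ | logPotential k y = c}}
  have hKc : K.Countable := Measure.countable_meas_level_set_pos (measurable_logPotential k)
  have hmeas : MeasurableSet
      {x : ℝ | 0 < volume {y : ℝ | logPotential k y = logPotential k x}} :=
    measurable_logPotential k hKc.measurableSet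
  rw [ae_restrict_iff' hmeas]
  let θ : ℕ → ℝ := fun n => 1 / ((n : ℝ) + 4)
  have hθ (n : ℕ) : 0 < θ n := by positivity
  have hθ4 (n : ℕ) : θ n ≤ 1 / 4 := by
    apply one_div_le_one_div_of_le <;> linarith [n.cast_nonneg (α := ℝ)]
  let A : ℕ → ℝ → ℕ → ℚ → Set ℝ := fun n c N q =>
    {z | ∀ y, 0 < y → y < 1 / ((N : ℝ) + 1) →
      |(planarLogPotential k z y - c) / y - q| ≤ θ n ^ 2}
  have hdens : ∀ᵐ x : ℝ, ∀ c ∈ K, ∀ n N q, x ∈ A n c N q →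
      Tendsto (fun r => volume (A n c N q ∩ Metric.closedBall x r) /
        volume (Metric.closedBall x r)) (𝓝[>] 0) (𝓝 1) := by
    rw [ae_ball_iff hKc]
    intro c _
    simp_rw [ae_all_iff]
    exact fun n N q =>
      ae_imp_of_ae_restrict (Besicovitch.ae_tendsto_measure_inter_div volume (A n c N q))
  filter_upwards [hdens, ae_exists_tendsto_measureReal_closedBall_div k] with x hx ⟨f, hf⟩ hxK
  obtain ⟨M, -, hM⟩ := exists_measureReal_closedBall_le hf
  obtain ⟨p, hp⟩ := exists_tendsto_poissonIntegral hf
  have hslope := tendsto_planarLogPotential_slope hB hkB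
    (measure_singleton_eq_zero_of_closedBall_le hM) (integrable_log_abs_sub hB hkB hM) hp
  have hbound (n : ℕ) :
      ∀ᶠ y in 𝓝[>] (0 : ℝ), |conjPoissonIntegral k x y| ≤ θ n * (4 + 12 * (p + 1)) := by
    have hε : 0 < θ n ^ 2 / 2 := by have := hθ n; positivity
    obtain ⟨q, hq1, hq2⟩ := exists_rat_btwn (lt_add_of_pos_right p hε)
    have hev := hslope.eventually (Metric.ball_mem_nhds p hε)
    obtain ⟨δ, hδ, hsub⟩ := mem_nhdsGT_iff_exists_Ioo_subset.1 hev
    obtain ⟨N, hN⟩ := exists_nat_one_div_lt (show (0 : ℝ) < δ from hδ)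
    have hxA : x ∈ A n (logPotential k x) N q := by
      intro y hy0 hyN
      have hy : dist _ p < _ := hsub ⟨hy0, hyN.trans hN⟩
      rw [Real.dist_eq, abs_lt] at hy
      rw [abs_le]
      constructor <;> linarith [hy.1, hy.2]
    filter_upwards [hp.eventually_le_const (lt_add_one p),
      eventually_abs_conjPoissonIntegral_le hB hkB (by positivity) (hθ n) (hθ4 n)
        (fun z hz => hz) hxA (hx _ hxK n N q hxA)] with y hy1 hy2
    have := hθ n
    exact hy2.trans (by gcongr)
  have hconj : Tendsto (conjPoissonIntegral k x) (𝓝[>] 0) (𝓝 0) := by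
    rw [Metric.tendsto_nhds]
    intro ε hε
    have hθlim : Tendsto (fun n => θ n * (4 + 12 * (p + 1))) atTop (𝓝 0) := by
      have h1 : Tendsto θ atTop (𝓝 0) :=
        (tendsto_const_nhds (x := (1 : ℝ))).div_atTop
          (tendsto_atTop_add_const_right _ _ tendsto_natCast_atTop_atTop)
      simpa using h1.mul_const (4 + 12 * (p + 1))
    obtain ⟨n, hn⟩ := (hθlim.eventually_lt_const hε).exists
    filter_upwards [hbound n] with y hy
    rw [Real.dist_eq, sub_zero]
    exact hy.trans_lt hn
  refine ⟨((0 : ℝ) : ℂ) + (p : ℂ) * Complex.I, ?_, by simp⟩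
  have hlim := ((Complex.continuous_ofReal.tendsto 0).comp hconj).add
    (((Complex.continuous_ofReal.tendsto p).comp hp).mul_const Complex.I)
  refine hlim.congr' ?_
  filter_upwards [self_mem_nhdsWithin] with y hy
  exact (integral_inv_sub_eq k x hy).symm
end
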